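/- Suppose the ℝ-building (Λ,F) is contained in a metrically complete ℝ-building (Λ',F') of the same type, and let Λ̄ be the closure of Λ in Λ'. Let α ∈ Λ̄ and let C_∞ be a chamber at infinity of Λ (the direction of a sector of Λ). Then the interior of the sector C_α of Λ' based at α with direction C_∞ is contained in Λ. -/

import Mathlib

open Set

noncomputable section

/-- The model space `𝔸`: Euclidean `n`-space. -/
abbrev ModelSpace (n : ℕ) : Type := EuclideanSpace ℝ (Fin n)

/-- A linear reflection of the model space: an involutive isometry, different from the
identity, whose fixed-point set is a linear hyperplane (the kernel of a nonzero linear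
functional). -/
def IsLinearReflection {n : ℕ} (s : ModelSpace n ≃ᵢ ModelSpace n) : Prop :=
  s * s = 1 ∧ s ≠ 1 ∧
    ∃ p : ModelSpace n →ₗ[ℝ] ℝ, p ≠ 0 ∧ {x | s x = x} = {x | p x = 0}

/-- A spherical Coxeter system of rank `n`, realized as a finite reflection group acting
on the model space `ℝⁿ`: a finite set `S` of linear reflections generating a finite
group `W̄`. -/
structure SphericalCoxeterSystem (n : ℕ) where
  S : Set (ModelSpace n ≃ᵢ ModelSpace n)
  finiteS : S.Finite
  refl : ∀ s ∈ S, IsLinearReflection s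
  finiteW : Finite ↥(Subgroup.closure S)

namespace SphericalCoxeterSystem

variable {n : ℕ}

/-- The finite reflection group `W̄` generated by `S`. -/
def Wbar (cs : SphericalCoxeterSystem n) : Subgroup (ModelSpace n ≃ᵢ ModelSpace n) :=
  Subgroup.closure cs.S

/-- A translation of the model space. -/
def IsTranslation (t : ModelSpace n ≃ᵢ ModelSpace n) : Prop :=
  ∃ v : ModelSpace n, ∀ x, t x = x + v

/-- The group `W` of affine transformations generated by `W̄` and all translations. -/
def W (cs : SphericalCoxeterSystem n) : Subgroup (ModelSpace n ≃ᵢ ModelSpace n) :=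
  Subgroup.closure (cs.S ∪ {t | IsTranslation t})

/-- An affine reflection: a `W`-conjugate of a generator in `S`. -/
def IsAffineReflection (cs : SphericalCoxeterSystem n)
    (r : ModelSpace n ≃ᵢ ModelSpace n) : Prop :=
  ∃ s ∈ cs.S, ∃ w ∈ cs.W, r = w * s * w⁻¹

/-- A wall of the model space: the fixed-point set of an affine reflection. -/
def IsModelWall (cs : SphericalCoxeterSystem n) (M : Set (ModelSpace n)) : Prop :=
  ∃ r, cs.IsAffineReflection r ∧ M = {x | r x = x}

/-- A half-apartment of the model space: a closed half-space `H` bounded by the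
wall `M` (fixed-point set of the affine reflection `r`). -/
def IsModelHalf (cs : SphericalCoxeterSystem n) (M H : Set (ModelSpace n)) : Prop :=
  ∃ r, cs.IsAffineReflection r ∧ M = {x | r x = x} ∧
    IsClosed H ∧ Convex ℝ H ∧ H ∪ (⇑r '' H) = univ ∧ H ∩ (⇑r '' H) = M

/-- A sector-face of the model space based at `x`: a closed cell of the arrangement of
all walls through `x` (for each wall through `x` one chooses either the wall itself or
one of its two half-apartments, and takes the intersection of the choices). -/
def IsModelSectorFace (cs : SphericalCoxeterSystem n) (x : ModelSpace n)
    (F : Set (ModelSpace n)) : Prop :=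
  F.Nonempty ∧ ∃ σ : Set (ModelSpace n) → Set (ModelSpace n),
    (∀ M, cs.IsModelWall M → x ∈ M → (σ M = M ∨ cs.IsModelHalf M (σ M))) ∧
    F = ⋂ M ∈ {M | cs.IsModelWall M ∧ x ∈ M}, σ M

/-- A sector of the model space based at `x`: a maximal sector-face based at `x`. -/
def IsModelSector (cs : SphericalCoxeterSystem n) (x : ModelSpace n)
    (F : Set (ModelSpace n)) : Prop :=
  cs.IsModelSectorFace x F ∧ ∀ F', cs.IsModelSectorFace x F' → F ⊆ F' → F' = F

/-- A sector-panel of the model space based at `x`: a sector-face of codimension one. -/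
def IsModelSectorPanel (cs : SphericalCoxeterSystem n) (x : ModelSpace n)
    (F : Set (ModelSpace n)) : Prop :=
  cs.IsModelSectorFace x F ∧ Module.finrank ℝ (affineSpan ℝ F).direction = n - 1

/-- The word length on `W̄` with respect to the generating set `S`. -/
def wordLength (cs : SphericalCoxeterSystem n) (w : ModelSpace n ≃ᵢ ModelSpace n) : ℕ :=
  sInf {k | ∃ l : List (ModelSpace n ≃ᵢ ModelSpace n),
    l.length = k ∧ (∀ s ∈ l, s ∈ cs.S) ∧ l.prod = w}

/-- The longest element of `W̄`. -/
def IsLongest (cs : SphericalCoxeterSystem n) (w : ModelSpace n ≃ᵢ ModelSpace n) : Prop :=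
  w ∈ cs.Wbar ∧ ∀ v ∈ cs.Wbar, cs.wordLength v ≤ cs.wordLength w

end SphericalCoxeterSystem

section Building

variable {n : ℕ} {X : Type*} [MetricSpace X]

/-- Two subsets of a metric space are parallel if their Hausdorff distance is finite. -/
def Par (S T : Set X) : Prop := EMetric.hausdorffEdist S T ≠ ⊤

/-- Two sets locally coincide at `α` (have the same germ at `α`) if their intersection
is a neighbourhood of `α` in both of them. -/
def LocCoin (α : X) (F F' : Set X) : Prop :=
  F ∩ F' ∈ nhdsWithin α F ∧ F ∩ F' ∈ nhdsWithin α F'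

variable (cs : SphericalCoxeterSystem n)

/-- An apartment: the image of a chart. -/
def IsApartment (Fc : Set (ModelSpace n → X)) (A : Set X) : Prop :=
  ∃ f ∈ Fc, A = range f

/-- A sector-face based at `α` : the image under a chart of a sector-face of the model
space, with base point mapped to `α`. -/
def IsSectorFaceAt (Fc : Set (ModelSpace n → X)) (α : X) (F : Set X) : Prop :=
  ∃ f ∈ Fc, ∃ x s, cs.IsModelSectorFace x s ∧ f x = α ∧ F = f '' s

/-- A sector based at `α`. -/
def IsSectorAt (Fc : Set (ModelSpace n → X)) (α : X) (F : Set X) : Prop :=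
  ∃ f ∈ Fc, ∃ x s, cs.IsModelSector x s ∧ f x = α ∧ F = f '' s

/-- A sector-panel based at `α`. -/
def IsSectorPanelAt (Fc : Set (ModelSpace n → X)) (α : X) (F : Set X) : Prop :=
  ∃ f ∈ Fc, ∃ x s, cs.IsModelSectorPanel x s ∧ f x = α ∧ F = f '' s

/-- A sector-face. -/
def IsSectorFace (Fc : Set (ModelSpace n → X)) (F : Set X) : Prop :=
  ∃ α, IsSectorFaceAt cs Fc α F

/-- A sector. -/
def IsSector (Fc : Set (ModelSpace n → X)) (F : Set X) : Prop :=
  ∃ α, IsSectorAt cs Fc α F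

/-- A sector-panel. -/
def IsSectorPanel (Fc : Set (ModelSpace n → X)) (F : Set X) : Prop :=
  ∃ α, IsSectorPanelAt cs Fc α F

/-- A wall: the image of a wall of the model space under a chart. -/
def IsWall (Fc : Set (ModelSpace n → X)) (M : Set X) : Prop :=
  ∃ f ∈ Fc, ∃ m, cs.IsModelWall m ∧ M = f '' m

/-- A half-apartment: the image of a half-apartment of the model space under a chart. -/
def IsHalfApartment (Fc : Set (ModelSpace n → X)) (H : Set X) : Prop :=
  ∃ f ∈ Fc, ∃ m h, cs.IsModelHalf m h ∧ H = f '' h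

/-- An ℝ-building of type `(W̄,S)` with set of points `Λ` inside the ambient metric
space `X` (taking `Λ` a subset of an ambient metric space makes it possible to speak of
one ℝ-building being contained in another): a set of isometric charts from the model
space satisfying the axioms (A1)–(A5). -/
structure RBuilding (cs : SphericalCoxeterSystem n) (X : Type*) [MetricSpace X]
    (Λ : Set X) : Type _ where
  charts : Set (ModelSpace n → X)
  isom : ∀ f ∈ charts, Isometry f
  into : ∀ f ∈ charts, range f ⊆ Λ
  A1 : ∀ f ∈ charts, ∀ w ∈ cs.W, (f ∘ ⇑w) ∈ charts
  A2 : ∀ f ∈ charts, ∀ g ∈ charts,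
        IsClosed {x | f x ∈ range g} ∧ Convex ℝ {x | f x ∈ range g} ∧
        ∃ w ∈ cs.W, ∀ x, f x ∈ range g → f x = g (w x)
  A3 : ∀ p ∈ Λ, ∀ q ∈ Λ, ∃ f ∈ charts, p ∈ range f ∧ q ∈ range f
  A4 : ∀ S₁ S₂, IsSector cs charts S₁ → IsSector cs charts S₂ →
        ∃ T₁ T₂ f, f ∈ charts ∧ IsSector cs charts T₁ ∧ IsSector cs charts T₂ ∧
          T₁ ⊆ S₁ ∧ T₂ ⊆ S₂ ∧ T₁ ⊆ range f ∧ T₂ ⊆ range f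
  A5 : ∀ f₁ ∈ charts, ∀ f₂ ∈ charts, ∀ f₃ ∈ charts,
        IsHalfApartment cs charts (range f₁ ∩ range f₂) →
        IsHalfApartment cs charts (range f₂ ∩ range f₃) →
        IsHalfApartment cs charts (range f₁ ∩ range f₃) →
        (range f₁ ∩ range f₂ ∩ range f₃).Nonempty

/-- The Weyl distance, inside the apartment given by the chart `f`, from the sector `S`
to the sector `S'` (both contained in that apartment): the element `w ∈ W̄` mapping the
sector of the model space based at the origin parallel to `f⁻¹(S)` to the one parallel
to `f⁻¹(S')`. -/
def WeylDistIn (f : ModelSpace n → X) (S S' : Set X)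
    (w : ModelSpace n ≃ᵢ ModelSpace n) : Prop :=
  w ∈ cs.Wbar ∧ ∃ s s', cs.IsModelSector 0 s ∧ cs.IsModelSector 0 s' ∧
    Par (f '' s) S ∧ Par (f '' s') S' ∧ ⇑w '' s = s'

/-- `w` is the Weyl distance from the germ at `α` of the sector `S` to the germ at `α`
of the sector `S'` (both based at `α`): computed via sectors based at `α` with the same
germs lying in a common apartment. -/
def GermWeylDist (Fc : Set (ModelSpace n → X)) (α : X) (S S' : Set X)
    (w : ModelSpace n ≃ᵢ ModelSpace n) : Prop :=
  ∃ f ∈ Fc, ∃ T T', IsSectorAt cs Fc α T ∧ IsSectorAt cs Fc α T' ∧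
    T ⊆ range f ∧ T' ⊆ range f ∧ LocCoin α S T ∧ LocCoin α S' T' ∧
    WeylDistIn cs f T T' w

/-- `w` is the Weyl distance between the chambers at infinity represented by the
sectors `S` and `S'`: computed via parallel sectors lying in a common apartment. -/
def ChamberWeylDist (Fc : Set (ModelSpace n → X)) (S S' : Set X)
    (w : ModelSpace n ≃ᵢ ModelSpace n) : Prop :=
  ∃ f ∈ Fc, ∃ T T', IsSector cs Fc T ∧ IsSector cs Fc T' ∧
    T ⊆ range f ∧ T' ⊆ range f ∧ Par T S ∧ Par T' S' ∧ WeylDistIn cs f T T' w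

/-- The germs at `α` of two sectors based at `α` are opposite if their Weyl distance is
the longest element of `W̄`. -/
def OppositeGerms (Fc : Set (ModelSpace n → X)) (α : X) (S S' : Set X) : Prop :=
  ∃ w, GermWeylDist cs Fc α S S' w ∧ cs.IsLongest w

/-- Two chambers at infinity (represented by the sectors `C`, `D`) are adjacent if they
are distinct and their Weyl distance lies in `S`. -/
def AdjacentChambers (Fc : Set (ModelSpace n → X)) (C D : Set X) : Prop :=
  ¬ Par C D ∧ ∃ s ∈ cs.S, ChamberWeylDist cs Fc C D s

/-- Two sector-panels are asymptotic if they contain a common subset which is itself a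
sector-panel. -/
def Asymptotic (Fc : Set (ModelSpace n → X)) (P P' : Set X) : Prop :=
  ∃ Q, IsSectorPanel cs Fc Q ∧ Q ⊆ P ∧ Q ⊆ P'

/-- An automorphism of an ℝ-building: an isometry `g` of `Λ` with `g ∘ f` a chart for
every chart `f`. -/
def RBuilding.IsAuto {Λ : Set X} (B : RBuilding cs X Λ) (g : ↥Λ ≃ᵢ ↥Λ) : Prop :=
  ∀ f (hf : f ∈ B.charts),
    (fun a : ModelSpace n =>
      ((g ⟨f a, B.into f hf (mem_range_self a)⟩ : ↥Λ) : X)) ∈ B.charts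

end Building

section CAT0

/-- `G` is a geodesic segment from `x` to `y`: an isometric image of a closed real
interval with endpoints `x` and `y`. -/
def IsGeodesicSegment {Y : Type*} [MetricSpace Y] (x y : Y) (G : Set Y) : Prop :=
  ∃ (a b : ℝ) (γ : ℝ → Y), a ≤ b ∧ γ a = x ∧ γ b = y ∧
    (∀ s ∈ Set.Icc a b, ∀ t ∈ Set.Icc a b, dist (γ s) (γ t) = |s - t|) ∧
    G = γ '' Set.Icc a b

/-- A CAT(0) space: a geodesic metric space in which every geodesic triangle satisfies
the CAT(0) comparison inequality with respect to comparison triangles in the Euclidean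
plane. -/
def IsCAT0Space (Y : Type*) [MetricSpace Y] : Prop :=
  (∀ x y : Y, ∃ G, IsGeodesicSegment x y G) ∧
  ∀ (x y z : Y) (G : Set Y), IsGeodesicSegment x y G → ∀ a ∈ G,
    ∀ x' y' z' : EuclideanSpace ℝ (Fin 2),
      dist x' y' = dist x y → dist y' z' = dist y z → dist x' z' = dist x z →
      ∀ a' ∈ segment ℝ x' y', dist x' a' = dist x a → dist z a ≤ dist z' a'

end CAT0

open scoped RealInnerProductSpace Topology

section UnitVectors

variable {n : ℕ}

/-- The linear reflection of the model space in the hyperplane orthogonal to `a`. -/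
def hyperplaneReflection (a : ModelSpace n) : ModelSpace n ≃ₗᵢ[ℝ] ModelSpace n :=
  (ℝ ∙ a)ᗮ.reflection

theorem hyperplaneReflection_apply {a : ModelSpace n} (ha : ‖a‖ = 1) (y : ModelSpace n) :
    hyperplaneReflection a y = y - (2 * ⟪a, y⟫) • a := by
  rw [hyperplaneReflection, Submodule.reflection_orthogonal_apply,
    Submodule.reflection_singleton_apply, ha]
  simp [two_smul, two_mul, add_smul]

theorem hyperplaneReflection_involutive (a y : ModelSpace n) :
    hyperplaneReflection a (hyperplaneReflection a y) = y :=
  Submodule.reflection_reflection _ y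

theorem inner_hyperplaneReflection {a : ModelSpace n} (ha : ‖a‖ = 1) (b y : ModelSpace n) :
    ⟪b, hyperplaneReflection a y⟫ = ⟪b, y⟫ - 2 * ⟪a, y⟫ * ⟪b, a⟫ := by
  rw [hyperplaneReflection_apply ha, inner_sub_right, inner_smul_right]

theorem inner_self_hyperplaneReflection {a : ModelSpace n} (ha : ‖a‖ = 1) (y : ModelSpace n) :
    ⟪a, hyperplaneReflection a y⟫ = -⟪a, y⟫ := by
  rw [inner_hyperplaneReflection ha, real_inner_self_eq_norm_sq, ha]
  ring

theorem hyperplaneReflection_of_inner_eq_zero {a y : ModelSpace n} (ha : ‖a‖ = 1)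
    (hy : ⟪a, y⟫ = 0) : hyperplaneReflection a y = y := by
  simp [hyperplaneReflection_apply ha, hy]

/-- Unit vectors with nested orthogonal hyperplanes agree up to sign. -/
theorem eq_or_eq_neg_of_orthogonal {a b : ModelSpace n} (ha : ‖a‖ = 1) (hb : ‖b‖ = 1)
    (h : ∀ y, ⟪a, y⟫ = 0 → ⟪b, y⟫ = 0) : b = a ∨ b = -a := by
  have haa : ⟪a, a⟫ = 1 := by rw [real_inner_self_eq_norm_sq, ha]; norm_num
  have hbb : ⟪b, b⟫ = 1 := by rw [real_inner_self_eq_norm_sq, hb]; norm_num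
  have h0 : ⟪a, b - ⟪a, b⟫ • a⟫ = 0 := by
    rw [inner_sub_right, inner_smul_right, haa]; ring
  have h1 := h _ h0
  have h2 : b - ⟪a, b⟫ • a = 0 := by
    rw [← inner_self_eq_zero (𝕜 := ℝ), inner_sub_left, h1, inner_smul_left, h0]
    simp
  have h3 : b = ⟪a, b⟫ • a := sub_eq_zero.1 h2
  have h4 : |⟪a, b⟫| = 1 := by
    have := congrArg norm h3
    rw [norm_smul, ha, hb, Real.norm_eq_abs] at this
    linarith
  rcases eq_or_eq_neg_of_abs_eq h4 with h5 | h5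
  · left; rw [h3, h5, one_smul]
  · right; rw [h3, h5, neg_one_smul]

/-- A linear isometry fixing a hyperplane pointwise is the identity or the reflection. -/
theorem eq_self_or_eq_hyperplaneReflection {a : ModelSpace n} (ha : ‖a‖ = 1)
    (L : ModelSpace n ≃ₗᵢ[ℝ] ModelSpace n) (hL : ∀ y, ⟪a, y⟫ = 0 → L y = y) :
    (∀ y, L y = y) ∨ ∀ y, L y = hyperplaneReflection a y := by
  have haa : ⟪a, a⟫ = 1 := by rw [real_inner_self_eq_norm_sq, ha]; norm_num
  have hdec : ∀ y, L y = y - ⟪a, y⟫ • a + ⟪a, y⟫ • L a := by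
    intro y
    have h0 : ⟪a, y - ⟪a, y⟫ • a⟫ = 0 := by
      rw [inner_sub_right, inner_smul_right, haa]; ring
    have := hL _ h0
    rw [map_sub, map_smul, sub_eq_iff_eq_add] at this
    exact this
  have hLa : L a = a ∨ L a = -a := by
    apply eq_or_eq_neg_of_orthogonal ha (by rw [L.norm_map, ha])
    intro y hy
    have := L.inner_map_map a y
    rwa [hL y hy, hy] at this
  rcases hLa with h | h
  · left; intro y; rw [hdec, h]; abel
  · right; intro y; rw [hdec, h, hyperplaneReflection_apply ha, smul_neg, two_mul, add_smul]; abel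

theorem hyperplaneReflection_map {a : ModelSpace n} (ha : ‖a‖ = 1)
    (L : ModelSpace n ≃ₗᵢ[ℝ] ModelSpace n) (y : ModelSpace n) :
    hyperplaneReflection (L a) (L y) = L (hyperplaneReflection a y) := by
  rw [hyperplaneReflection_apply ha, hyperplaneReflection_apply (by rw [L.norm_map, ha]),
    L.inner_map_map, map_sub, map_smul]

theorem hyperplaneReflection_neg (a y : ModelSpace n) (ha : ‖a‖ = 1) :
    hyperplaneReflection (-a) y = hyperplaneReflection a y := by
  rw [hyperplaneReflection_apply ha, hyperplaneReflection_apply (by rw [norm_neg, ha])]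
  simp

end UnitVectors

namespace SphericalCoxeterSystem

variable {n : ℕ} (cs : SphericalCoxeterSystem n)

/-- A linear isometry lying in the finite reflection group `W̄`. -/
def IsLinear (L : ModelSpace n ≃ₗᵢ[ℝ] ModelSpace n) : Prop :=
  L.toIsometryEquiv ∈ cs.Wbar

/-- A root: a unit normal vector of the wall of a linear reflection. -/
def IsRoot (a : ModelSpace n) : Prop :=
  ‖a‖ = 1 ∧ ∃ s ∈ cs.S, ∃ w ∈ cs.Wbar, (hyperplaneReflection a).toIsometryEquiv = w * s * w⁻¹

variable {cs}

theorem IsLinear.refl : cs.IsLinear (LinearIsometryEquiv.refl ℝ _) := cs.Wbar.one_mem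

theorem IsLinear.trans {L M : ModelSpace n ≃ₗᵢ[ℝ] ModelSpace n} (hL : cs.IsLinear L)
    (hM : cs.IsLinear M) : cs.IsLinear (L.trans M) := cs.Wbar.mul_mem hM hL

theorem IsLinear.symm {L : ModelSpace n ≃ₗᵢ[ℝ] ModelSpace n} (hL : cs.IsLinear L) :
    cs.IsLinear L.symm := cs.Wbar.inv_mem hL

theorem exists_isLinear_of_mem_Wbar {w : ModelSpace n ≃ᵢ ModelSpace n} (hw : w ∈ cs.Wbar) :
    ∃ L, cs.IsLinear L ∧ ∀ x, w x = L x := by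
  have h0 : w 0 = 0 := by
    refine Subgroup.closure_induction (p := fun w _ => w 0 = 0) ?_ ?_ ?_ ?_ hw
    · intro s hs
      obtain ⟨-, -, p, -, hp⟩ := cs.refl s hs
      have : (0 : ModelSpace n) ∈ {x | p x = 0} := map_zero p
      rwa [← hp] at this
    · rfl
    · intro x y _ _ hx hy
      rw [IsometryEquiv.mul_apply, hy, hx]
    · intro x _ hx
      exact x.injective (by rw [IsometryEquiv.apply_inv_self, hx])
  refine ⟨w.toRealLinearIsometryEquivOfMapZero h0, ?_, fun x => rfl⟩
  have : (w.toRealLinearIsometryEquivOfMapZero h0).toIsometryEquiv = w := by ext; rfl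
  rwa [IsLinear, this]

theorem Wbar_le_W : cs.Wbar ≤ cs.W := Subgroup.closure_mono subset_union_left

theorem exists_affine_of_mem_W {w : ModelSpace n ≃ᵢ ModelSpace n} (hw : w ∈ cs.W) :
    ∃ L, cs.IsLinear L ∧ ∃ t, ∀ x, w x = L x + t := by
  refine Subgroup.closure_induction
    (p := fun w _ => ∃ L, cs.IsLinear L ∧ ∃ t, ∀ x, w x = L x + t) ?_ ?_ ?_ ?_ hw
  · rintro s (hs | ⟨t, ht⟩)
    · obtain ⟨L, hL, h⟩ := exists_isLinear_of_mem_Wbar (cs := cs) (Subgroup.subset_closure hs)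
      exact ⟨L, hL, 0, fun x => by rw [h, add_zero]⟩
    · exact ⟨_, IsLinear.refl, t, ht⟩
  · exact ⟨_, IsLinear.refl, 0, fun x => (add_zero x).symm⟩
  · rintro x y _ _ ⟨L, hL, t, ht⟩ ⟨M, hM, u, hu⟩
    refine ⟨M.trans L, hM.trans hL, L u + t, fun z => ?_⟩
    rw [IsometryEquiv.mul_apply, hu, ht, map_add, add_assoc]; rfl
  · rintro x _ ⟨L, hL, t, ht⟩
    refine ⟨L.symm, hL.symm, -L.symm t, fun z => x.injective ?_⟩
    rw [IsometryEquiv.apply_inv_self, ht]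
    simp

theorem exists_mem_W {L : ModelSpace n ≃ₗᵢ[ℝ] ModelSpace n} (hL : cs.IsLinear L)
    (t : ModelSpace n) : ∃ w ∈ cs.W, ∀ x, w x = L x + t := by
  refine ⟨IsometryEquiv.addRight t * L.toIsometryEquiv, cs.W.mul_mem
    (Subgroup.subset_closure (Or.inr ⟨t, fun x => rfl⟩)) (Wbar_le_W hL), fun x => rfl⟩

namespace IsRoot

variable {a b : ModelSpace n}

theorem norm_eq (ha : cs.IsRoot a) : ‖a‖ = 1 := ha.1

theorem inner_self (ha : cs.IsRoot a) : ⟪a, a⟫ = 1 := by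
  rw [real_inner_self_eq_norm_sq, ha.1]; norm_num

theorem isLinear (ha : cs.IsRoot a) : cs.IsLinear (hyperplaneReflection a) := by
  obtain ⟨-, s, hs, w, hw, h⟩ := ha
  rw [IsLinear, h]
  exact cs.Wbar.mul_mem (cs.Wbar.mul_mem hw (Subgroup.subset_closure hs)) (cs.Wbar.inv_mem hw)

theorem neg (ha : cs.IsRoot a) : cs.IsRoot (-a) := by
  obtain ⟨h1, s, hs, w, hw, h⟩ := ha
  refine ⟨by rw [norm_neg, h1], s, hs, w, hw, ?_⟩
  rw [← h]
  ext1 y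
  exact hyperplaneReflection_neg a y h1

theorem map (ha : cs.IsRoot a) {L : ModelSpace n ≃ₗᵢ[ℝ] ModelSpace n} (hL : cs.IsLinear L) :
    cs.IsRoot (L a) := by
  obtain ⟨h1, s, hs, w, hw, h⟩ := ha
  refine ⟨by rw [L.norm_map, h1], s, hs, L.toIsometryEquiv * w, cs.Wbar.mul_mem hL hw, ?_⟩
  have : (hyperplaneReflection (L a)).toIsometryEquiv =
      L.toIsometryEquiv * (hyperplaneReflection a).toIsometryEquiv * L.toIsometryEquiv⁻¹ := by
    ext1 y
    have := hyperplaneReflection_map h1 L (L.symm y)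
    rw [L.apply_symm_apply] at this
    exact this
  rw [this, h, mul_inv_rev]
  simp only [mul_assoc]

end IsRoot

theorem finite_setOf_isRoot : {a | cs.IsRoot a}.Finite := by
  have hW : (cs.Wbar : Set (ModelSpace n ≃ᵢ ModelSpace n)).Finite := cs.finiteW
  refine Set.Finite.of_finite_fibers
    (fun a => (hyperplaneReflection a).toIsometryEquiv) (hW.subset ?_) ?_
  · rintro _ ⟨a, ha, rfl⟩
    exact IsRoot.isLinear ha
  · rintro _ ⟨a, ha, rfl⟩
    refine (Set.toFinite {a, -a}).subset ?_
    rintro b ⟨hb, hab⟩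
    apply eq_or_eq_neg_of_orthogonal ha.1 hb.1
    intro y hy
    have h1 : hyperplaneReflection b y = hyperplaneReflection a y :=
      DFunLike.congr_fun (show (hyperplaneReflection b).toIsometryEquiv = _ from hab) y
    rw [hyperplaneReflection_of_inner_eq_zero ha.1 hy] at h1
    have h2 := inner_self_hyperplaneReflection hb.1 y
    rw [h1] at h2
    linarith

theorem exists_isRoot_of_mem_S {s : ModelSpace n ≃ᵢ ModelSpace n} (hs : s ∈ cs.S) :
    ∃ a, cs.IsRoot a ∧ ∀ y, s y = hyperplaneReflection a y := by
  obtain ⟨-, hs1, p, hp, hfix⟩ := cs.refl s hs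
  obtain ⟨L, hL, hsL⟩ := exists_isLinear_of_mem_Wbar (cs := cs) (Subgroup.subset_closure hs)
  obtain ⟨c, hc⟩ : ∃ c : ModelSpace n, ∀ y, p y = ⟪c, y⟫ := by
    refine ⟨(InnerProductSpace.toDual ℝ _).symm (LinearMap.toContinuousLinearMap p), fun y => ?_⟩
    rw [InnerProductSpace.toDual_symm_apply]; rfl
  have hc0 : c ≠ 0 := by
    rintro rfl
    exact hp (LinearMap.ext fun y => by rw [hc, inner_zero_left]; rfl)
  have hn : ‖‖c‖⁻¹ • c‖ = 1 := norm_smul_inv_norm (𝕜 := ℝ) hc0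
  have key : ∀ y, ⟪‖c‖⁻¹ • c, y⟫ = 0 → L y = y := by
    intro y hy
    rw [inner_smul_left] at hy
    have hy' : ⟪c, y⟫ = 0 := by simpa [hc0] using hy
    have : y ∈ {x | s x = x} := by rw [hfix]; exact (hc y).trans hy'
    rw [← hsL]; exact this
  rcases eq_self_or_eq_hyperplaneReflection hn L key with h | h
  · exact absurd (IsometryEquiv.ext fun y => by rw [hsL, h]; rfl) hs1
  · refine ⟨‖c‖⁻¹ • c, ⟨hn, s, hs, 1, cs.Wbar.one_mem, ?_⟩, fun y => by rw [hsL, h]⟩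
    ext1 y
    simp [hsL, h]

theorem IsAffineReflection.exists_isRoot {r : ModelSpace n ≃ᵢ ModelSpace n}
    (hr : cs.IsAffineReflection r) :
    ∃ a, cs.IsRoot a ∧ ∃ c : ℝ, ∀ y, r y = y - (2 * (⟪a, y⟫ - c)) • a := by
  obtain ⟨s, hs, w, hw, rfl⟩ := hr
  obtain ⟨a, ha, hsa⟩ := exists_isRoot_of_mem_S hs
  obtain ⟨L, hL, t, ht⟩ := exists_affine_of_mem_W hw
  refine ⟨L a, ha.map hL, ⟪L a, t⟫, fun y => ?_⟩
  obtain ⟨z, rfl⟩ := w.surjective y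
  have h1 : (w * s * w⁻¹) (w z) = w (s z) := by
    rw [IsometryEquiv.mul_apply, IsometryEquiv.inv_apply_self, IsometryEquiv.mul_apply]
  rw [h1, hsa, ht, ht, hyperplaneReflection_apply ha.1, map_sub, map_smul, inner_add_right,
    L.inner_map_map, add_sub_cancel_right]
  abel

theorem IsRoot.exists_isAffineReflection {a : ModelSpace n} (ha : cs.IsRoot a) (c : ℝ) :
    ∃ r, cs.IsAffineReflection r ∧ ∀ y, r y = y - (2 * (⟪a, y⟫ - c)) • a := by
  have haa := ha.inner_self
  obtain ⟨h1, s, hs, w, hw, h⟩ := ha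
  let τ : ModelSpace n ≃ᵢ ModelSpace n := IsometryEquiv.addRight (c • a)
  have hτ : τ ∈ cs.W := Subgroup.subset_closure (Or.inr ⟨c • a, fun x => rfl⟩)
  refine ⟨τ * w * s * (τ * w)⁻¹, ⟨s, hs, τ * w, cs.W.mul_mem hτ (Wbar_le_W hw), rfl⟩,
    fun y => ?_⟩
  have h2 : τ * w * s * (τ * w)⁻¹ = τ * (hyperplaneReflection a).toIsometryEquiv * τ⁻¹ := by
    rw [h, mul_inv_rev]; simp only [mul_assoc]
  obtain ⟨z, rfl⟩ := τ.surjective y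
  rw [h2, IsometryEquiv.mul_apply, IsometryEquiv.inv_apply_self, IsometryEquiv.mul_apply]
  change hyperplaneReflection a z + c • a = z + c • a - (2 * (⟪a, z + c • a⟫ - c)) • a
  rw [hyperplaneReflection_apply h1, inner_add_right, inner_smul_right, haa, mul_one,
    add_sub_cancel_right]
  abel

theorem setOf_affineReflection_eq {a : ModelSpace n} (ha : cs.IsRoot a) {c : ℝ}
    {r : ModelSpace n ≃ᵢ ModelSpace n} (hr : ∀ y, r y = y - (2 * (⟪a, y⟫ - c)) • a) :
    {x | r x = x} = {y | ⟪a, y⟫ = c} := by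
  have ha0 : a ≠ 0 := by
    rintro rfl
    simpa using ha.1
  ext y
  simp [hr, ha0, sub_eq_zero]

theorem IsModelWall.exists_isRoot {M : Set (ModelSpace n)} (hM : cs.IsModelWall M) :
    ∃ a, cs.IsRoot a ∧ ∃ c : ℝ, M = {y | ⟪a, y⟫ = c} := by
  obtain ⟨r, hr, rfl⟩ := hM
  obtain ⟨a, ha, c, h⟩ := hr.exists_isRoot
  exact ⟨a, ha, c, setOf_affineReflection_eq ha h⟩

theorem IsRoot.isModelWall {a : ModelSpace n} (ha : cs.IsRoot a) (c : ℝ) :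
    cs.IsModelWall {y | ⟪a, y⟫ = c} := by
  obtain ⟨r, hr, h⟩ := ha.exists_isAffineReflection c
  exact ⟨r, hr, (setOf_affineReflection_eq ha h).symm⟩

theorem isClosed_le_inner (a : ModelSpace n) (c : ℝ) : IsClosed {y : ModelSpace n | c ≤ ⟪a, y⟫} :=
  isClosed_le continuous_const (continuous_const.inner continuous_id)

theorem convex_le_inner (a : ModelSpace n) (c : ℝ) : Convex ℝ {y : ModelSpace n | c ≤ ⟪a, y⟫} :=
  convex_halfSpace_ge (innerₗ _ a).isLinear c

theorem image_affineReflection {a : ModelSpace n} (ha : cs.IsRoot a) {c : ℝ}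
    {r : ModelSpace n ≃ᵢ ModelSpace n} (hr : ∀ y, r y = y - (2 * (⟪a, y⟫ - c)) • a)
    (H : Set (ModelSpace n)) : r '' H = {y | r y ∈ H} := by
  have hinv : ∀ y, r (r y) = y := by
    intro y
    rw [hr (r y), hr y, inner_sub_right, inner_smul_right, ha.inner_self, sub_sub, ← add_smul]
    simp only [sub_eq_self]
    convert zero_smul ℝ a using 2
    ring
  ext y
  constructor
  · rintro ⟨z, hz, rfl⟩
    rw [mem_ofPred_eq, hinv]; exact hz
  · intro hy
    exact ⟨r y, hy, hinv y⟩

theorem IsRoot.isModelHalf {a : ModelSpace n} (ha : cs.IsRoot a) (c : ℝ) :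
    cs.IsModelHalf {y | ⟪a, y⟫ = c} {y | c ≤ ⟪a, y⟫} := by
  obtain ⟨r, hr, h⟩ := ha.exists_isAffineReflection c
  have hin : ∀ y, ⟪a, r y⟫ = 2 * c - ⟪a, y⟫ := by
    intro y
    rw [h, inner_sub_right, inner_smul_right, ha.inner_self]; ring
  refine ⟨r, hr, (setOf_affineReflection_eq ha h).symm, isClosed_le_inner a c,
    convex_le_inner a c, ?_, ?_⟩
  · rw [image_affineReflection ha h]
    ext y
    simp only [mem_union, mem_ofPred_eq, hin, mem_univ, iff_true]
    by_contra! hcon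
    linarith [hcon.1, hcon.2]
  · rw [image_affineReflection ha h]
    ext y
    simp only [mem_inter_iff, mem_ofPred_eq, hin]
    constructor
    · rintro ⟨h1, h2⟩; linarith
    · intro h1; constructor <;> linarith

/-- Two roots defining the same hyperplane agree up to sign. -/
theorem IsRoot.eq_or_eq_neg_of_setOf_eq {a b : ModelSpace n} (ha : cs.IsRoot a)
    (hb : cs.IsRoot b) {c d : ℝ} (h : {y | ⟪a, y⟫ = c} = {y | ⟪b, y⟫ = d}) :
    b = a ∨ b = -a := by
  apply eq_or_eq_neg_of_orthogonal ha.1 hb.1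
  intro y hy
  have h1 : c • a ∈ {y | ⟪a, y⟫ = c} := by
    simp [inner_smul_right, ha.norm_eq]
  have h2 : c • a + y ∈ {y | ⟪a, y⟫ = c} := by
    simp [inner_add_right, inner_smul_right, ha.norm_eq, hy]
  rw [h] at h1 h2
  rw [mem_ofPred_eq] at h1 h2
  rw [inner_add_right, h1] at h2
  linarith

/-- A half-apartment of the model space is a closed half-space. -/
theorem IsModelHalf.eq_or_eq {a : ModelSpace n} {c : ℝ} {H : Set (ModelSpace n)}
    (ha : cs.IsRoot a) (hH : cs.IsModelHalf {y | ⟪a, y⟫ = c} H) :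
    H = {y | c ≤ ⟪a, y⟫} ∨ H = {y | ⟪a, y⟫ ≤ c} := by
  obtain ⟨r, hr, hM, hcl, hcv, hun, hint⟩ := hH
  obtain ⟨b, hb, d, h⟩ := hr.exists_isRoot
  rw [setOf_affineReflection_eq hb h] at hM
  rw [image_affineReflection hb h] at hun hint
  have hin : ∀ y, ⟪a, r y⟫ = 2 * c - ⟪a, y⟫ := by
    intro y
    have hp : c • a ∈ {y | ⟪b, y⟫ = d} := by
      rw [← hM]; simp [inner_smul_right, ha.norm_eq]
    rw [mem_ofPred_eq, inner_smul_right] at hp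
    rw [h, inner_sub_right, inner_smul_right]
    rcases ha.eq_or_eq_neg_of_setOf_eq hb hM with rfl | rfl
    · rw [ha.inner_self] at hp ⊢; linarith
    · rw [inner_neg_left, ha.inner_self] at hp
      rw [inner_neg_left, inner_neg_right, ha.inner_self]; linarith
  have hMH : ∀ y, ⟪a, y⟫ = c → y ∈ H := fun y hy =>
    (hint ▸ (show y ∈ {y | ⟪a, y⟫ = c} from hy) : y ∈ H ∩ _).1
  have hsep : ∀ z ∈ H, ∀ z' ∈ H, c < ⟪a, z⟫ → ⟪a, z'⟫ < c → False := by
    intro z hz z' hz' h1 h2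
    have slab : ∀ u ∈ H, ∀ y, ⟪a, u⟫ ≠ c → ∀ θ, 0 ≤ θ → θ < 1 →
        ⟪a, y⟫ = c + θ * (⟪a, u⟫ - c) → y ∈ H := by
      intro u hu y huc θ h0 h1 hy
      have h1' : 1 - θ ≠ 0 := by linarith
      have hm : (1 - θ)⁻¹ • (y - θ • u) ∈ H := by
        apply hMH
        rw [inner_smul_right, inner_sub_right, inner_smul_right, hy]
        field_simp; ring
      have := hcv hm hu (a := 1 - θ) (b := θ) (by linarith) h0 (by ring)
      rwa [smul_smul, mul_inv_cancel₀ h1', one_smul, sub_add_cancel] at this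
    set p := ⟪a, z⟫ - c with hp
    set q := c - ⟪a, z'⟫ with hq
    have hp0 : 0 < p := by linarith
    have hq0 : 0 < q := by linarith
    set ε := min p q / 2 with hε
    have hε0 : 0 < ε := half_pos (lt_min hp0 hq0)
    have hεp : ε < p := by have := min_le_left p q; linarith
    have hεq : ε < q := by have := min_le_right p q; linarith
    have hy1 : (c + ε) • a ∈ H := by
      refine slab z hz _ h1.ne' (ε / p) (by positivity) ((div_lt_one hp0).2 hεp) ?_
      rw [inner_smul_right, ha.inner_self, ← hp]; field_simp
    have hy2 : r ((c + ε) • a) ∈ H := by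
      refine slab z' hz' _ h2.ne (ε / q) (by positivity) ((div_lt_one hq0).2 hεq) ?_
      rw [hin, inner_smul_right, ha.inner_self, show ⟪a, z'⟫ - c = -q by rw [hq]; ring]
      field_simp; ring
    have : (c + ε) • a ∈ {y | ⟪a, y⟫ = c} := hint ▸ ⟨hy1, hy2⟩
    rw [mem_ofPred_eq, inner_smul_right, ha.inner_self] at this
    linarith
  have hor : ∀ y, y ∈ H ∨ r y ∈ H := fun y => by
    have : y ∈ H ∪ {y | r y ∈ H} := hun ▸ mem_univ y
    exact this
  by_cases hex : ∃ z ∈ H, c < ⟪a, z⟫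
  · obtain ⟨z, hz, h1⟩ := hex
    left
    ext y
    constructor
    · intro hy
      by_contra hlt
      exact hsep z hz y hy h1 (not_le.1 hlt)
    · intro hy
      rcases (show c ≤ ⟪a, y⟫ from hy).eq_or_lt with h2 | h2
      · exact hMH y h2.symm
      · rcases hor y with h3 | h3
        · exact h3
        · exact (hsep z hz _ h3 h1 (by rw [hin]; linarith)).elim
  · push Not at hex
    right
    ext y
    refine ⟨fun hy => hex y hy, fun hy => ?_⟩
    rcases (show ⟪a, y⟫ ≤ c from hy).eq_or_lt with h2 | h2
    · exact hMH y h2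
    · rcases hor y with h3 | h3
      · exact h3
      · have := hex _ h3
        rw [hin] at this
        linarith

end SphericalCoxeterSystem

namespace SphericalCoxeterSystem

variable {n : ℕ} {cs : SphericalCoxeterSystem n}

section Chamber

variable (cs)

/-- A vector of the model space lying on no wall through the origin. -/
def IsRegular (v : ModelSpace n) : Prop := ∀ a, cs.IsRoot a → ⟪a, v⟫ ≠ 0

/-- The closed Weyl chamber containing the regular vector `v`. -/
def chamber (v : ModelSpace n) : Set (ModelSpace n) :=
  {y | ∀ a, cs.IsRoot a → 0 < ⟪a, v⟫ → 0 ≤ ⟪a, y⟫}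

variable {cs} {u v y z : ModelSpace n} {L : ModelSpace n ≃ₗᵢ[ℝ] ModelSpace n}

theorem zero_mem_chamber : (0 : ModelSpace n) ∈ cs.chamber v := fun a _ _ => by
  rw [inner_zero_right]

theorem self_mem_chamber : v ∈ cs.chamber v := fun _ _ h => h.le

theorem add_mem_chamber (hy : y ∈ cs.chamber v) (hz : z ∈ cs.chamber v) :
    y + z ∈ cs.chamber v := fun a ha h => by
  rw [inner_add_right]; exact add_nonneg (hy a ha h) (hz a ha h)

theorem smul_mem_chamber {r : ℝ} (hr : 0 ≤ r) (hy : y ∈ cs.chamber v) :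
    r • y ∈ cs.chamber v := fun a ha h => by
  rw [inner_smul_right]; exact mul_nonneg hr (hy a ha h)

theorem neg_mem_chamber (hy : y ∈ cs.chamber v) : -y ∈ cs.chamber (-v) := fun a ha h => by
  rw [inner_neg_right] at h ⊢
  have := hy (-a) ha.neg (by rwa [inner_neg_left])
  rwa [inner_neg_left] at this

theorem map_mem_chamber (hL : cs.IsLinear L) (hy : y ∈ cs.chamber v) :
    L y ∈ cs.chamber (L v) := fun a ha h => by
  have key : ∀ x, ⟪a, L x⟫ = ⟪L.symm a, x⟫ := fun x => by
    rw [← L.inner_map_map (L.symm a) x, L.apply_symm_apply]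
  rw [key] at h ⊢
  exact hy _ (ha.map hL.symm) h

theorem IsRegular.map (hv : cs.IsRegular v) (hL : cs.IsLinear L) : cs.IsRegular (L v) :=
  fun a ha h => by
    apply hv _ (ha.map hL.symm)
    rw [← L.inner_map_map, L.apply_symm_apply, h]

theorem IsRegular.neg (hv : cs.IsRegular v) : cs.IsRegular (-v) := fun a ha h => by
  rw [inner_neg_right, neg_eq_zero] at h
  exact hv a ha h

theorem isClosed_chamber : IsClosed (cs.chamber v) := by
  simp only [chamber, ofPred_forall]
  exact isClosed_iInter fun a => isClosed_iInter fun _ => isClosed_iInter fun _ =>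
    isClosed_le_inner a 0

theorem exists_forall_nonneg_inner {A : Set (ModelSpace n)} (hA : A.Finite) {m : ModelSpace n}
    (hm : ∀ b ∈ A, 0 < ⟪b, m⟫) (y : ModelSpace n) :
    ∃ N : ℝ, 0 ≤ N ∧ ∀ b ∈ A, 0 ≤ ⟪b, N • m + y⟫ := by
  have h1 : ∀ b ∈ A, ∀ᶠ N : ℝ in Filter.atTop, 0 ≤ ⟪b, N • m + y⟫ := by
    intro b hb
    filter_upwards [Filter.eventually_ge_atTop (-⟪b, y⟫ / ⟪b, m⟫)] with N hN
    rw [inner_add_right, inner_smul_right]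
    rw [div_le_iff₀ (hm b hb)] at hN
    linarith
  obtain ⟨N, h0, h⟩ :=
    ((Filter.eventually_ge_atTop (0 : ℝ)).and ((Set.Finite.eventually_all hA).2 h1)).exists
  exact ⟨N, h0, h⟩

theorem exists_smul_add_mem_chamber (v y : ModelSpace n) :
    ∃ N : ℝ, 0 ≤ N ∧ N • v + y ∈ cs.chamber v := by
  obtain ⟨N, h0, h⟩ := exists_forall_nonneg_inner (A := {a | cs.IsRoot a ∧ 0 < ⟪a, v⟫})
    (finite_setOf_isRoot.subset fun a ha => ha.1) (fun b hb => hb.2) y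
  exact ⟨N, h0, fun a ha hav => h a ⟨ha, hav⟩⟩

theorem exists_sub_mem_chamber (v y z : ModelSpace n) :
    ∃ x, x - y ∈ cs.chamber v ∧ x - z ∈ cs.chamber v := by
  obtain ⟨M, hM, hy⟩ := exists_smul_add_mem_chamber (cs := cs) v (-y)
  obtain ⟨N, hN, hz⟩ := exists_smul_add_mem_chamber (cs := cs) v (-z)
  refine ⟨M • v + N • v, ?_, ?_⟩
  · have := add_mem_chamber hy (smul_mem_chamber hN self_mem_chamber)
    convert this using 1; abel
  · have := add_mem_chamber hz (smul_mem_chamber hM self_mem_chamber)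
    convert this using 1; abel

theorem eq_self_of_eq_self_on_chamber (h : ∀ y ∈ cs.chamber v, L y = y) (y : ModelSpace n) :
    L y = y := by
  obtain ⟨N, hN, hy⟩ := exists_smul_add_mem_chamber (cs := cs) v y
  have h1 := h _ hy
  rw [map_add, h _ (smul_mem_chamber hN self_mem_chamber)] at h1
  exact add_left_cancel h1

theorem eq_of_forall_dist_eq (h : ∀ d ∈ cs.chamber v, dist d y = dist d z) : y = z := by
  have key : ∀ d ∈ cs.chamber v, ‖y‖ ^ 2 - 2 * ⟪d, y⟫ = ‖z‖ ^ 2 - 2 * ⟪d, z⟫ := by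
    intro d hd
    have h1 := congrArg (· ^ 2) (h d hd)
    simp only [dist_eq_norm, norm_sub_sq_real] at h1
    linarith
  have h0 := key 0 zero_mem_chamber
  simp only [inner_zero_left] at h0
  obtain ⟨N, hN, hy⟩ := exists_smul_add_mem_chamber (cs := cs) v (y - z)
  have h1 := key _ hy
  have h2 := key _ (smul_mem_chamber hN self_mem_chamber)
  rw [inner_add_left, inner_add_left] at h1
  have : ⟪y - z, y - z⟫ = 0 := by
    rw [inner_sub_right]; linarith
  exact sub_eq_zero.1 (inner_self_eq_zero.1 this)

theorem chamber_eq_of_mem (hv : cs.IsRegular v) (hu : cs.IsRegular u) (h : v ∈ cs.chamber u) :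
    cs.chamber v = cs.chamber u := by
  have key : ∀ a, cs.IsRoot a → (0 < ⟪a, v⟫ ↔ 0 < ⟪a, u⟫) := by
    intro a ha
    constructor
    · intro h1
      by_contra h2
      have h3 := h (-a) ha.neg (by
        rw [inner_neg_left]
        have := lt_of_le_of_ne (not_lt.1 h2) (hu a ha)
        linarith)
      rw [inner_neg_left] at h3
      linarith
    · intro h1
      exact lt_of_le_of_ne (h a ha h1) (hv a ha).symm
  ext y
  exact forall_congr' fun a => forall_congr' fun ha => by rw [key a ha]

theorem finite_setOf_chamber : (range (cs.chamber)).Finite := by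
  refine ((finite_setOf_isRoot (cs := cs)).finite_subsets.image
    fun P => {y | ∀ a ∈ P, 0 ≤ ⟪a, y⟫}).subset ?_
  rintro _ ⟨v, rfl⟩
  refine ⟨{a | cs.IsRoot a ∧ 0 < ⟪a, v⟫}, fun a ha => ha.1, ?_⟩
  ext y
  exact ⟨fun h a ha hv => h a ⟨ha, hv⟩, fun h a ha => h a ha.1 ha.2⟩

theorem exists_isRegular : ∃ u, cs.IsRegular u := by
  have := (finite_setOf_isRoot (cs := cs)).to_subtype
  obtain ⟨f, hf⟩ := Module.exists_dual_forall_apply_ne_zero (K := ℝ)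
    (fun a : {a | cs.IsRoot a} => (a : ModelSpace n)) (fun a h => by
      have := a.2.norm_eq
      rw [h, norm_zero] at this
      exact zero_ne_one this)
  refine ⟨(InnerProductSpace.toDual ℝ _).symm (LinearMap.toContinuousLinearMap f),
    fun a ha => ?_⟩
  rw [real_inner_comm, InnerProductSpace.toDual_symm_apply]
  exact hf ⟨a, ha⟩

theorem exists_isRegular_near (y : ModelSpace n) :
    ∃ v, cs.IsRegular v ∧ ∀ a, cs.IsRoot a → ⟪a, y⟫ ≠ 0 → 0 < ⟪a, y⟫ * ⟪a, v⟫ := by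
  obtain ⟨u, hu⟩ := exists_isRegular (cs := cs)
  have h1 : ∀ a ∈ {a | cs.IsRoot a}, ∀ᶠ N : ℝ in Filter.atTop,
      ⟪a, N • y + u⟫ ≠ 0 ∧ (⟪a, y⟫ ≠ 0 → 0 < ⟪a, y⟫ * ⟪a, N • y + u⟫) := by
    intro a ha
    by_cases h : ⟪a, y⟫ = 0
    · refine Filter.Eventually.of_forall fun N => ⟨?_, fun h' => absurd h h'⟩
      rw [inner_add_right, inner_smul_right, h, mul_zero, zero_add]
      exact hu a ha
    · have hpos : 0 < ⟪a, y⟫ * ⟪a, y⟫ := mul_self_pos.2 h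
      filter_upwards [Filter.eventually_gt_atTop (-(⟪a, y⟫ * ⟪a, u⟫) / (⟪a, y⟫ * ⟪a, y⟫))]
        with N hN
      rw [div_lt_iff₀ hpos] at hN
      have : 0 < ⟪a, y⟫ * ⟪a, N • y + u⟫ := by
        rw [inner_add_right, inner_smul_right]
        linarith
      exact ⟨right_ne_zero_of_mul this.ne', fun _ => this⟩
  obtain ⟨N, h⟩ := ((Set.Finite.eventually_all finite_setOf_isRoot).2 h1).exists
  exact ⟨N • y + u, fun a ha => (h a ha).1, fun a ha => (h a ha).2⟩

theorem exists_isRegular_mem_chamber (y : ModelSpace n) :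
    ∃ v, cs.IsRegular v ∧ y ∈ cs.chamber v := by
  obtain ⟨v, hv, h⟩ := exists_isRegular_near (cs := cs) y
  refine ⟨v, hv, fun a ha hav => ?_⟩
  by_contra hcon
  have := h a ha (not_le.1 hcon).ne
  nlinarith [not_le.1 hcon]

end Chamber

section Sector

variable {x v : ModelSpace n} {F : Set (ModelSpace n)}

/-- Every sector-face is contained in a translated closed chamber. -/
theorem IsModelSectorFace.exists_subset (hF : cs.IsModelSectorFace x F) :
    ∃ v, cs.IsRegular v ∧ F ⊆ {y | y - x ∈ cs.chamber v} := by
  obtain ⟨⟨z, hz⟩, σ, hσ, rfl⟩ := hF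
  set F := ⋂ M ∈ {M | cs.IsModelWall M ∧ x ∈ M}, σ M with hFdef
  have hmem : ∀ y, y ∈ F ↔ ∀ M, cs.IsModelWall M → x ∈ M → y ∈ σ M := fun y => by
    simp [hFdef]
  have hcond : ∀ a, cs.IsRoot a → σ {y | ⟪a, y⟫ = ⟪a, x⟫} = {y | ⟪a, y⟫ = ⟪a, x⟫} ∨
      σ {y | ⟪a, y⟫ = ⟪a, x⟫} = {y | ⟪a, x⟫ ≤ ⟪a, y⟫} ∨
      σ {y | ⟪a, y⟫ = ⟪a, x⟫} = {y | ⟪a, y⟫ ≤ ⟪a, x⟫} := by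
    intro a ha
    rcases hσ _ (ha.isModelWall ⟪a, x⟫) rfl with h | h
    · exact Or.inl h
    · exact Or.inr (h.eq_or_eq ha)
  have hmemF : ∀ y ∈ F, ∀ a, cs.IsRoot a → y ∈ σ {y | ⟪a, y⟫ = ⟪a, x⟫} := fun y hy a ha =>
    (hmem y).1 hy _ (ha.isModelWall _) rfl
  -- points of a face never lie strictly on opposite sides of a wall
  have hsign : ∀ y ∈ F, ∀ y' ∈ F, ∀ a, cs.IsRoot a → 0 ≤ ⟪a, y - x⟫ * ⟪a, y' - x⟫ := by
    intro y hy y' hy' a ha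
    have h1 := hmemF y hy a ha
    have h2 := hmemF y' hy' a ha
    rw [inner_sub_right, inner_sub_right]
    rcases hcond a ha with h | h | h <;> rw [h, mem_ofPred_eq] at h1 h2
    · rw [h1, h2]; simp
    · exact mul_nonneg (sub_nonneg.2 h1) (sub_nonneg.2 h2)
    · exact mul_nonneg_of_nonpos_of_nonpos (sub_nonpos.2 h1) (sub_nonpos.2 h2)
  have hadd : ∀ y ∈ F, ∀ y' ∈ F, y + y' - x ∈ F := by
    intro y hy y' hy'
    rw [hmem]
    intro M hM hxM
    obtain ⟨a, ha, c, rfl⟩ := hM.exists_isRoot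
    obtain rfl : ⟪a, x⟫ = c := hxM
    have h1 := hmemF y hy a ha
    have h2 := hmemF y' hy' a ha
    rcases hcond a ha with h | h | h <;> rw [h, mem_ofPred_eq] at h1 h2 <;> rw [h, mem_ofPred_eq,
      inner_sub_right, inner_add_right] <;> linarith
  let N : ModelSpace n → ℕ := fun y => {a | cs.IsRoot a ∧ ⟪a, y - x⟫ = 0}.ncard
  obtain ⟨y₀, hy₀, hmin⟩ : ∃ y₀ ∈ F, ∀ y ∈ F, N y₀ ≤ N y :=
    ⟨Function.argminOn N F ⟨z, hz⟩, Function.argminOn_mem .., fun y hy =>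
      Function.argminOn_le N F hy⟩
  obtain ⟨v, hv, hnear⟩ := exists_isRegular_near (cs := cs) (y₀ - x)
  refine ⟨v, hv, fun y hy a ha hav => ?_⟩
  by_cases h0 : ⟪a, y₀ - x⟫ = 0
  · by_contra hcon
    have hne : ⟪a, y - x⟫ ≠ 0 := fun h => hcon h.ge
    have hlt : N (y₀ + y - x) < N y₀ := by
      apply Set.ncard_lt_ncard _ (finite_setOf_isRoot.subset fun a ha => ha.1)
      refine ⟨?_, fun hsub => ?_⟩
      · rintro b ⟨hb, hb0⟩
        refine ⟨hb, ?_⟩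
        have h1 := hsign y₀ hy₀ y hy b hb
        rw [show y₀ + y - x - x = (y₀ - x) + (y - x) by abel, inner_add_right] at hb0
        rw [show ⟪b, y - x⟫ = -⟪b, y₀ - x⟫ by linarith] at h1
        nlinarith [mul_self_nonneg ⟪b, y₀ - x⟫]
      · have := (hsub ⟨ha, h0⟩).2
        rw [show y₀ + y - x - x = (y₀ - x) + (y - x) by abel, inner_add_right, h0,
          zero_add] at this
        exact hne this
    exact absurd (hmin _ (hadd y₀ hy₀ y hy)) (not_le.2 hlt)
  · have h1 := hnear a ha h0
    have h2 : 0 < ⟪a, y₀ - x⟫ := pos_of_mul_pos_left h1 hav.le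
    exact nonneg_of_mul_nonneg_right (hsign y₀ hy₀ y hy a ha) h2

theorem IsRegular.isModelSectorFace (hv : cs.IsRegular v) (x : ModelSpace n) :
    cs.IsModelSectorFace x {y | y - x ∈ cs.chamber v} := by
  refine ⟨⟨x, by simpa using zero_mem_chamber⟩, fun M => {y | ∀ a, cs.IsRoot a →
    M = {z | ⟪a, z⟫ = ⟪a, x⟫} → 0 < ⟪a, v⟫ → ⟪a, x⟫ ≤ ⟪a, y⟫}, ?_, ?_⟩
  · intro M hM hxM
    right
    obtain ⟨a, ha, hav, rfl⟩ : ∃ a, cs.IsRoot a ∧ 0 < ⟪a, v⟫ ∧ M = {z | ⟪a, z⟫ = ⟪a, x⟫} := by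
      obtain ⟨a, ha, c, rfl⟩ := hM.exists_isRoot
      obtain rfl : ⟪a, x⟫ = c := hxM
      rcases (hv a ha).lt_or_gt with h | h
      · exact ⟨-a, ha.neg, by rw [inner_neg_left]; linarith, by simp [inner_neg_left]⟩
      · exact ⟨a, ha, h, rfl⟩
    convert ha.isModelHalf ⟪a, x⟫ using 1
    ext y
    constructor
    · intro h
      exact h a ha rfl hav
    · intro h b hb hM' hbv
      rcases ha.eq_or_eq_neg_of_setOf_eq hb hM' with rfl | rfl
      · exact h
      · rw [inner_neg_left] at hbv; linarith
  · ext y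
    simp only [mem_iInter, mem_ofPred_eq]
    constructor
    · intro h M _ a ha _ hav
      have := h a ha hav
      rw [inner_sub_right] at this
      linarith
    · intro h a ha hav
      have := h _ ⟨ha.isModelWall ⟪a, x⟫, rfl⟩ a ha rfl hav
      rw [inner_sub_right]
      linarith

theorem IsRegular.isModelSector (hv : cs.IsRegular v) (x : ModelSpace n) :
    cs.IsModelSector x {y | y - x ∈ cs.chamber v} := by
  refine ⟨hv.isModelSectorFace x, fun F' hF' hsub => hsub.antisymm' ?_⟩
  obtain ⟨u, hu, hFu⟩ := hF'.exists_subset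
  have hvu : v ∈ cs.chamber u := by
    have := hFu (hsub (show x + v ∈ _ by simpa using self_mem_chamber))
    simpa using this
  rw [chamber_eq_of_mem hv hu hvu]
  exact hFu

/-- Sectors of the model space are translated closed chambers. -/
theorem IsModelSector.exists_eq (hF : cs.IsModelSector x F) :
    ∃ v, cs.IsRegular v ∧ F = {y | y - x ∈ cs.chamber v} := by
  obtain ⟨v, hv, hsub⟩ := hF.1.exists_subset
  exact ⟨v, hv, (hF.2 _ (hv.isModelSectorFace x) hsub).symm⟩

end Sector

section Adjacent

variable (cs)

/-- The hyperplane orthogonal to the root `a` supports a panel of the chamber of `v`, and `m` lies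
in the relative interior of this panel. -/
structure IsPanel (v a m : ModelSpace n) : Prop where
  isRoot : cs.IsRoot a
  pos : 0 < ⟪a, v⟫
  inner_eq_zero : ⟪a, m⟫ = 0
  mul_pos : ∀ b, cs.IsRoot b → b ≠ a → b ≠ -a → 0 < ⟪b, m⟫ * ⟪b, v⟫

variable {cs} {v a m y : ModelSpace n}

namespace IsPanel

theorem isRegular (h : cs.IsPanel v a m) : cs.IsRegular v := by
  intro b hb
  by_cases h1 : b = a
  · rw [h1]; exact h.pos.ne'
  by_cases h2 : b = -a
  · rw [h2, inner_neg_left]; exact neg_ne_zero.2 h.pos.ne'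
  exact right_ne_zero_of_mul (h.mul_pos b hb h1 h2).ne'

theorem neg (h : cs.IsPanel v a m) : cs.IsPanel (-v) (-a) (-m) where
  isRoot := h.isRoot.neg
  pos := by rw [inner_neg_neg]; exact h.pos
  inner_eq_zero := by rw [inner_neg_neg]; exact h.inner_eq_zero
  mul_pos b hb h1 h2 := by
    rw [inner_neg_right, inner_neg_right, neg_mul_neg]
    exact h.mul_pos b hb (by rwa [neg_neg] at h2) h1

theorem reflect (h : cs.IsPanel v a m) : cs.IsPanel (hyperplaneReflection a v) (-a) m where
  isRoot := h.isRoot.neg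
  pos := by
    rw [inner_neg_left, inner_self_hyperplaneReflection h.isRoot.norm_eq, neg_neg]
    exact h.pos
  inner_eq_zero := by rw [inner_neg_left, h.inner_eq_zero, neg_zero]
  mul_pos b hb h1 h2 := by
    have key : ∀ y, ⟪hyperplaneReflection a b, y⟫ = ⟪b, hyperplaneReflection a y⟫ := by
      intro y
      rw [← LinearIsometryEquiv.inner_map_map (hyperplaneReflection a),
        hyperplaneReflection_involutive]
    have ha : hyperplaneReflection a a = -a := by
      rw [hyperplaneReflection_apply h.isRoot.norm_eq, h.isRoot.inner_self, mul_one, two_smul]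
      abel
    have hba : ∀ c, hyperplaneReflection a b = c → b = hyperplaneReflection a c := by
      rintro c rfl
      rw [hyperplaneReflection_involutive]
    have := h.mul_pos (hyperplaneReflection a b) (hb.map h.isRoot.isLinear)
      (fun h3 => h1 (by rw [hba _ h3, ha]))
      (fun h3 => h2 (by rw [hba _ h3, map_neg, ha]))
    rwa [key, key, hyperplaneReflection_of_inner_eq_zero h.isRoot.norm_eq h.inner_eq_zero] at this

theorem mem_chamber_reflect (h : cs.IsPanel v a m) (hy : y ∈ cs.chamber v) (h0 : ⟪a, y⟫ = 0) :
    y ∈ cs.chamber (hyperplaneReflection a v) := by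
  rw [← hyperplaneReflection_of_inner_eq_zero h.isRoot.norm_eq h0]
  exact map_mem_chamber h.isRoot.isLinear hy

theorem exists_smul_add_mem (h : cs.IsPanel v a m) (hy : 0 ≤ ⟪a, y⟫) :
    ∃ N : ℝ, 0 ≤ N ∧ N • m + y ∈ cs.chamber v := by
  obtain ⟨N, h0, hN⟩ := exists_forall_nonneg_inner
    (A := {b | cs.IsRoot b ∧ 0 < ⟪b, v⟫ ∧ b ≠ a})
    (finite_setOf_isRoot.subset fun a ha => ha.1) (m := m) (fun b hb => by
      refine pos_of_mul_pos_left (h.mul_pos b hb.1 hb.2.2 ?_) hb.2.1.le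
      rintro rfl
      have := hb.2.1
      rw [inner_neg_left] at this
      linarith [h.pos]) y
  refine ⟨N, h0, fun b hb hbv => ?_⟩
  by_cases hba : b = a
  · rw [hba, inner_add_right, inner_smul_right, h.inner_eq_zero, mul_zero, zero_add]
    exact hy
  · exact hN b ⟨hb, hbv, hba⟩

theorem mem_chamber (h : cs.IsPanel v a m) : m ∈ cs.chamber v := by
  intro b hb hbv
  by_cases h1 : b = a
  · rw [h1, h.inner_eq_zero]
  by_cases h2 : b = -a
  · rw [h2, inner_neg_left, h.inner_eq_zero, neg_zero]
  exact (pos_of_mul_pos_left (h.mul_pos b hb h1 h2) hbv.le).le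

/-- A linear isometry fixing a panel pointwise is the identity or the reflection. -/
theorem eq_self_or_eq_reflection (h : cs.IsPanel v a m) (L : ModelSpace n ≃ₗᵢ[ℝ] ModelSpace n)
    (hL : ∀ y ∈ cs.chamber v, ⟪a, y⟫ = 0 → L y = y) :
    (∀ y, L y = y) ∨ ∀ y, L y = hyperplaneReflection a y := by
  refine eq_self_or_eq_hyperplaneReflection h.isRoot.norm_eq L fun y hy => ?_
  obtain ⟨N, hN, hmem⟩ := h.exists_smul_add_mem hy.ge
  have h1 := hL _ hmem (by
    rw [inner_add_right, inner_smul_right, h.inner_eq_zero, hy, mul_zero, zero_add])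
  have h2 := hL (N • m) (smul_mem_chamber hN h.mem_chamber) (by
    rw [inner_smul_right, h.inner_eq_zero, mul_zero])
  rw [map_add, h2] at h1
  exact add_left_cancel h1

end IsPanel

/-- If two chambers differ, some panel of the first one separates them. -/
theorem exists_isPanel {v d : ModelSpace n} (hv : cs.IsRegular v) (hd : d ∉ cs.chamber v) :
    ∃ a m, cs.IsPanel v a m ∧ ⟪a, d⟫ < 0 := by
  classical
  let P : Finset (ModelSpace n) := (finite_setOf_isRoot (cs := cs)).toFinset.filter
    fun a => 0 < ⟪a, v⟫
  have hP : ∀ a, a ∈ P ↔ cs.IsRoot a ∧ 0 < ⟪a, v⟫ := fun a => by simp [P]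
  obtain ⟨Δ, hΔP, hΔ⟩ := exists_minimal_le_of_wellFoundedLT
    (fun Δ : Finset (ModelSpace n) => ∀ x, (∀ a ∈ Δ, 0 ≤ ⟪a, x⟫) → x ∈ cs.chamber v) P
    (fun x hx a ha hav => hx a ((hP a).2 ⟨ha, hav⟩))
  obtain ⟨a, haΔ, had⟩ : ∃ a ∈ Δ, ⟪a, d⟫ < 0 := by
    by_contra! hcon
    exact hd (hΔ.prop d hcon)
  obtain ⟨ha, hav⟩ := (hP a).1 (hΔP haΔ)
  obtain ⟨x, hx, hxv⟩ : ∃ x, (∀ b ∈ Δ.erase a, 0 ≤ ⟪b, x⟫) ∧ x ∉ cs.chamber v := by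
    by_contra! hcon
    exact Finset.notMem_erase a Δ (hΔ.le_of_le hcon (Finset.erase_subset a Δ) haΔ)
  have hax : ⟪a, x⟫ < 0 := by
    by_contra hcon
    refine hxv (hΔ.prop x fun b hb => ?_)
    by_cases hba : b = a
    · rw [hba]; exact not_lt.1 hcon
    · exact hx b (Finset.mem_erase.2 ⟨hba, hb⟩)
  set m := (-⟪a, x⟫) • v + ⟪a, v⟫ • x with hm
  have ham : ⟪a, m⟫ = 0 := by
    rw [hm, inner_add_right, inner_smul_right, inner_smul_right]; ring
  have hbm : ∀ b ∈ Δ.erase a, 0 < ⟪b, m⟫ := by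
    intro b hb
    have h1 := ((hP b).1 (hΔP (Finset.mem_of_mem_erase hb))).2
    rw [hm, inner_add_right, inner_smul_right, inner_smul_right]
    have := mul_pos (neg_pos.2 hax) h1
    have := mul_nonneg hav.le (hx b hb)
    linarith
  have hmem : ∀ y, ⟪a, y⟫ = 0 → ∃ N : ℝ, 0 ≤ N ∧ N • m + y ∈ cs.chamber v := by
    intro y hy
    obtain ⟨N, hN, h⟩ := exists_forall_nonneg_inner (A := ↑(Δ.erase a)) (Finset.finite_toSet _)
      hbm y
    refine ⟨N, hN, hΔ.prop _ fun b hb => ?_⟩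
    by_cases hba : b = a
    · rw [hba, inner_add_right, inner_smul_right, ham, hy]; simp
    · exact h b (Finset.mem_coe.2 (Finset.mem_erase.2 ⟨hba, hb⟩))
  have hmv : m ∈ cs.chamber v := hΔ.prop _ fun b hb => by
    by_cases hba : b = a
    · rw [hba, ham]
    · exact (hbm b (Finset.mem_erase.2 ⟨hba, hb⟩)).le
  have hpos : ∀ b, cs.IsRoot b → b ≠ a → b ≠ -a → 0 < ⟪b, v⟫ → 0 < ⟪b, m⟫ := by
    intro b hb h1 h2 hbv
    refine lt_of_le_of_ne (hmv b hb hbv) fun h0 => ?_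
    have hge : ∀ y, ⟪a, y⟫ = 0 → 0 ≤ ⟪b, y⟫ := by
      intro y hy
      obtain ⟨N, -, h⟩ := hmem y hy
      have := h b hb hbv
      rwa [inner_add_right, inner_smul_right, ← h0, mul_zero, zero_add] at this
    rcases eq_or_eq_neg_of_orthogonal ha.norm_eq hb.norm_eq fun y hy => le_antisymm (by
      have := hge (-y) (by rw [inner_neg_right, hy, neg_zero])
      rw [inner_neg_right] at this
      linarith) (hge y hy) with h | h
    · exact h1 h
    · exact h2 h
  refine ⟨a, m, ⟨ha, hav, ham, fun b hb h1 h2 => ?_⟩, had⟩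
  rcases (hv b hb).lt_or_gt with h | h
  · have := hpos (-b) hb.neg (fun h3 => h2 (by rw [← h3, neg_neg]))
      (fun h3 => h1 (neg_injective h3)) (by rw [inner_neg_left]; linarith)
    rw [inner_neg_left] at this
    exact mul_pos_of_neg_of_neg (by linarith) h
  · exact mul_pos (hpos b hb h1 h2 h) h

end Adjacent

end SphericalCoxeterSystem

section Convexity

variable {n : ℕ} {K : Set (ModelSpace n)} {u x y : ModelSpace n}

/-- The direction of a ray contained in a closed convex set is a direction of recession. -/
theorem IsClosed.add_mem_of_ray (hc : IsClosed K) (hK : Convex ℝ K) (hx : x ∈ K)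
    (h : ∀ ρ : ℝ, 0 ≤ ρ → u + ρ • y ∈ K) : x + y ∈ K := by
  have h1 : Filter.Tendsto (fun ε : ℝ => (1 - ε) • x + ε • (u + ε⁻¹ • y)) (𝓝[>] 0)
      (𝓝 (x + y)) := by
    have h2 : Filter.Tendsto (fun ε : ℝ => (1 - ε) • x + ε • u + y) (𝓝[>] 0) (𝓝 (x + y)) := by
      have h3 : Continuous fun ε : ℝ => (1 - ε) • x + ε • u + y := by fun_prop
      have h4 := (h3.tendsto 0).mono_left (nhdsWithin_le_nhds (s := Ioi 0))
      simpa using h4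
    refine h2.congr' ?_
    filter_upwards [self_mem_nhdsWithin] with ε hε
    rw [smul_add, smul_inv_smul₀ (ne_of_gt hε), add_assoc]
  refine hc.mem_of_tendsto h1 ?_
  filter_upwards [Ioo_mem_nhdsGT (zero_lt_one' ℝ)] with ε hε
  exact hK hx (h _ (inv_nonneg.2 hε.1.le)) (by linarith [hε.2]) hε.1.le (by ring)

theorem eq_univ_or_exists_eq_halfSpace {a : ModelSpace n} (ha : ‖a‖ = 1) (hc : IsClosed K)
    (hK : Convex ℝ K) {b : ℝ} (hb : {y | b ≤ ⟪a, y⟫} ⊆ K) :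
    K = univ ∨ ∃ b' : ℝ, K = {y | b' ≤ ⟪a, y⟫} := by
  have haa : ⟪a, a⟫ = 1 := by rw [real_inner_self_eq_norm_sq, ha]; norm_num
  have hup : ∀ x z, x ∈ K → ⟪a, x⟫ ≤ ⟪a, z⟫ → z ∈ K := by
    intro x z hx hz
    have := hc.add_mem_of_ray hK hx (u := b • a) (y := z - x) fun ρ hρ => hb <| by
      change b ≤ ⟪a, b • a + ρ • (z - x)⟫
      rw [inner_add_right, inner_smul_right, inner_smul_right, inner_sub_right, haa]
      nlinarith
    rwa [add_sub_cancel] at this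
  have hin : ∀ t : ℝ, ⟪a, t • a⟫ = t := fun t => by rw [inner_smul_right, haa, mul_one]
  let I : Set ℝ := {t | t • a ∈ K}
  have hI : ∀ y, y ∈ K ↔ ⟪a, y⟫ ∈ I := fun y =>
    ⟨fun h => hup _ _ h (hin _).ge, fun h => hup _ _ h (hin _).le⟩
  have hIne : I.Nonempty := ⟨b, hb (hin b).ge⟩
  have hIcl : IsClosed I := hc.preimage (by fun_prop : Continuous fun t : ℝ => t • a)
  by_cases hbd : BddBelow I
  · refine Or.inr ⟨sInf I, ?_⟩
    ext y
    rw [hI]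
    refine ⟨fun h => csInf_le hbd h, fun h => ?_⟩
    refine hup _ _ (hIcl.csInf_mem hIne hbd) ?_
    rw [hin, hin]; exact h
  · refine Or.inl (eq_univ_of_forall fun y => ?_)
    rw [not_bddBelow_iff] at hbd
    obtain ⟨t, ht, hlt⟩ := hbd ⟪a, y⟫
    exact hup _ _ ht ((hin t).trans_le hlt.le)

/-- A map which is Lipschitz on each member of a finite closed cover of an interval is Lipschitz
on the interval. -/
theorem dist_le_of_finite_closed_cover {Y ι : Type*} [PseudoMetricSpace Y] {φ : ℝ → Y} {C : ℝ}
    {T : ι → Set ℝ} (hT : ∀ j, IsClosed (T j))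
    (hφ : ∀ j, ∀ s ∈ T j, ∀ t ∈ T j, s ≤ t → dist (φ s) (φ t) ≤ C * (t - s))
    (J : Finset ι) {p q : ℝ} (hpq : p ≤ q) (hJ : Icc p q ⊆ ⋃ j ∈ J, T j) :
    dist (φ p) (φ q) ≤ C * (q - p) := by
  classical
  induction J using Finset.strongInduction generalizing p with
  | H J ih =>
    obtain ⟨j, hj, hpj⟩ := mem_iUnion₂.1 (hJ (left_mem_Icc.2 hpq))
    have hbd : BddAbove (T j ∩ Icc p q) := bddAbove_Icc.mono inter_subset_right
    have hmem : sSup (T j ∩ Icc p q) ∈ T j ∩ Icc p q :=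
      ((hT j).inter isClosed_Icc).csSup_mem ⟨p, hpj, left_mem_Icc.2 hpq⟩ hbd
    set t := sSup (T j ∩ Icc p q) with ht
    have h1 := hφ j p hpj t hmem.1 hmem.2.1
    rcases eq_or_lt_of_le hmem.2.2 with h | hlt
    · rwa [h] at h1
    have h2 : dist (φ t) (φ q) ≤ C * (q - t) := by
      refine ih (J.erase j) (Finset.erase_ssubset hj) hlt.le ?_
      have hcl : IsClosed (⋃ i ∈ J.erase j, T i) :=
        isClosed_biUnion_finset fun i _ => hT i
      rw [← closure_Ioc hlt.ne]
      refine closure_minimal (fun s hs => ?_) hcl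
      have hs' : s ∈ Icc p q := ⟨hmem.2.1.trans hs.1.le, hs.2⟩
      obtain ⟨i, hi, hsi⟩ := mem_iUnion₂.1 (hJ hs')
      refine mem_iUnion₂.2 ⟨i, Finset.mem_erase.2 ⟨?_, hi⟩, hsi⟩
      rintro rfl
      exact (le_csSup hbd ⟨hsi, hs'⟩).not_gt hs.1
    calc dist (φ p) (φ q) ≤ dist (φ p) (φ t) + dist (φ t) (φ q) := dist_triangle _ _ _
      _ ≤ C * (t - p) + C * (q - t) := add_le_add h1 h2
      _ = C * (q - p) := by ring

end Convexity

section AsymptoticRays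

variable {n : ℕ} {X : Type*} [MetricSpace X] {f g h : ModelSpace n → X}
  {u x y z y' z' : ModelSpace n}

/-- The image under `f` of the ray spanned by `y` is at bounded distance from the image under `g`
of the ray spanned by `z`. -/
def AsymptoticRays (f : ModelSpace n → X) (y : ModelSpace n) (g : ModelSpace n → X)
    (z : ModelSpace n) : Prop :=
  ∃ C : ℝ, ∀ ρ : ℝ, 0 ≤ ρ → dist (f (ρ • y)) (g (ρ • z)) ≤ C

namespace AsymptoticRays

theorem refl (f : ModelSpace n → X) (y : ModelSpace n) : AsymptoticRays f y f y :=
  ⟨0, fun _ _ => (dist_self _).le⟩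

theorem symm (h : AsymptoticRays f y g z) : AsymptoticRays g z f y := by
  obtain ⟨C, hC⟩ := h
  exact ⟨C, fun ρ hρ => by rw [dist_comm]; exact hC ρ hρ⟩

theorem trans (h₁ : AsymptoticRays f y g z) (h₂ : AsymptoticRays g z h x) :
    AsymptoticRays f y h x := by
  obtain ⟨C, hC⟩ := h₁
  obtain ⟨D, hD⟩ := h₂
  exact ⟨C + D, fun ρ hρ =>
    (dist_triangle _ (g (ρ • z)) _).trans (add_le_add (hC ρ hρ) (hD ρ hρ))⟩

theorem dist_le (hf : Isometry f) (hg : Isometry g) (h₁ : AsymptoticRays f y g z)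
    (h₂ : AsymptoticRays f y' g z') : dist z z' ≤ dist y y' := by
  obtain ⟨C, hC⟩ := h₁
  obtain ⟨D, hD⟩ := h₂
  by_contra! hlt
  have key : ∀ ρ : ℝ, 0 ≤ ρ → ρ * (dist z z' - dist y y') ≤ C + D := by
    intro ρ hρ
    have h1 : dist (g (ρ • z)) (g (ρ • z')) = ρ * dist z z' := by
      rw [hg.dist_eq, dist_smul₀, Real.norm_of_nonneg hρ]
    have h2 : dist (f (ρ • y)) (f (ρ • y')) = ρ * dist y y' := by
      rw [hf.dist_eq, dist_smul₀, Real.norm_of_nonneg hρ]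
    have h3 := dist_triangle4 (g (ρ • z)) (f (ρ • y)) (f (ρ • y')) (g (ρ • z'))
    rw [h1, h2, dist_comm (g (ρ • z))] at h3
    have h4 := hC ρ hρ
    have h5 := hD ρ hρ
    linarith
  have hpos := sub_pos.2 hlt
  have hCD : 0 ≤ C + D := by simpa using key 0 le_rfl
  have h6 := key ((C + D + 1) / (dist z z' - dist y y')) (by positivity)
  rw [div_mul_cancel₀ _ hpos.ne'] at h6
  linarith

theorem dist_eq (hf : Isometry f) (hg : Isometry g) (h₁ : AsymptoticRays f y g z)
    (h₂ : AsymptoticRays f y' g z') : dist y y' = dist z z' :=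
  (dist_le hg hf h₁.symm h₂.symm).antisymm (dist_le hf hg h₁ h₂)

theorem eq (hf : Isometry f) (h : AsymptoticRays f y f z) : y = z :=
  dist_eq_zero.1 ((dist_eq hf hf (.refl f y) h).symm.trans (dist_self y))

theorem of_eq (hf : Isometry f) (hg : Isometry g) {t : ModelSpace n}
    (h : ∀ ρ : ℝ, 0 ≤ ρ → f (u + ρ • y) = g (ρ • z + t)) : AsymptoticRays f y g z := by
  refine ⟨‖u‖ + ‖t‖, fun ρ hρ => ?_⟩
  have h1 := dist_triangle (f (ρ • y)) (f (u + ρ • y)) (g (ρ • z))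
  have h2 : dist (f (ρ • y)) (f (u + ρ • y)) = ‖u‖ := by
    rw [hf.dist_eq, dist_eq_norm, sub_add_cancel_right, norm_neg]
  have h3 : dist (f (u + ρ • y)) (g (ρ • z)) = ‖t‖ := by
    rw [h ρ hρ, hg.dist_eq, dist_eq_norm, add_sub_cancel_left]
  rwa [h2, h3] at h1

end AsymptoticRays

end AsymptoticRays

namespace SphericalCoxeterSystem

variable {n : ℕ} {cs : SphericalCoxeterSystem n} {X : Type*} [MetricSpace X]
  {f g h : ModelSpace n → X} {v y z : ModelSpace n}

theorem convex_chamber : Convex ℝ (cs.chamber v) := fun _ hy _ hz _ _ hr hs _ =>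
  add_mem_chamber (smul_mem_chamber hr hy) (smul_mem_chamber hs hz)

variable (cs)

/-- The charts `f` and `g` send the chamber of `v` to asymptotic sectors, compatibly with the
parametrizations. -/
def AsymptoticOn (f g : ModelSpace n → X) (v : ModelSpace n) : Prop :=
  ∀ y ∈ cs.chamber v, AsymptoticRays f y g y

/-- The charts `f` and `g` agree on a subsector of the chamber of `v`. -/
def AgreeOn {Y : Type*} (f g : ModelSpace n → Y) (v : ModelSpace n) : Prop :=
  ∃ u, ∀ y ∈ cs.chamber v, f (u + y) = g (u + y)

variable {cs}

namespace AsymptoticOn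

theorem refl (f : ModelSpace n → X) (v : ModelSpace n) : cs.AsymptoticOn f f v :=
  fun y _ => .refl f y

theorem symm (h : cs.AsymptoticOn f g v) : cs.AsymptoticOn g f v := fun y hy => (h y hy).symm

theorem trans (h₁ : cs.AsymptoticOn f g v) (h₂ : cs.AsymptoticOn g h v) :
    cs.AsymptoticOn f h v := fun y hy => (h₁ y hy).trans (h₂ y hy)

end AsymptoticOn

theorem AgreeOn.asymptoticOn (hf : Isometry f) (hg : Isometry g) (h : cs.AgreeOn f g v) :
    cs.AsymptoticOn f g v := fun y hy => by
  obtain ⟨u, hu⟩ := h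
  refine .of_eq hf hg (u := u) (t := u) fun ρ hρ => ?_
  rw [hu _ (smul_mem_chamber hρ hy), add_comm]

theorem AgreeOn.symm {Y : Type*} {f g : ModelSpace n → Y} (h : cs.AgreeOn f g v) : cs.AgreeOn g f v := by
  obtain ⟨u, hu⟩ := h
  exact ⟨u, fun y hy => (hu y hy).symm⟩

theorem AgreeOn.trans {Y : Type*} {f g h : ModelSpace n → Y} (h₁ : cs.AgreeOn f g v) (h₂ : cs.AgreeOn g h v) :
    cs.AgreeOn f h v := by
  obtain ⟨u, hu⟩ := h₁
  obtain ⟨t, ht⟩ := h₂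
  obtain ⟨x, hx, hx'⟩ := exists_sub_mem_chamber (cs := cs) v u t
  refine ⟨x, fun y hy => ?_⟩
  have h1 := hu _ (add_mem_chamber hx hy)
  have h2 := ht _ (add_mem_chamber hx' hy)
  rw [← add_assoc, add_sub_cancel] at h1 h2
  exact h1.trans h2

end SphericalCoxeterSystem

namespace RBuilding

open SphericalCoxeterSystem

variable {n : ℕ} {cs : SphericalCoxeterSystem n} {X : Type*} [MetricSpace X] {Λ : Set X}
  (B : RBuilding cs X Λ) {f g h k : ModelSpace n → X} {v e : ModelSpace n}
  {L : ModelSpace n ≃ₗᵢ[ℝ] ModelSpace n}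

include B

theorem comp_affine_mem (hf : f ∈ B.charts) (hL : cs.IsLinear L) (t : ModelSpace n) :
    (fun y => f (L y + t)) ∈ B.charts := by
  obtain ⟨w, hw, h⟩ := exists_mem_W hL t
  have := B.A1 f hf w hw
  rwa [show f ∘ ⇑w = fun y => f (L y + t) from funext fun y => by rw [Function.comp_apply, h]]
    at this

theorem comp_add_mem (hf : f ∈ B.charts) (t : ModelSpace n) : (fun y => f (y + t)) ∈ B.charts :=
  B.comp_affine_mem hf .refl t

theorem exists_transition (hf : f ∈ B.charts) (hg : g ∈ B.charts) :
    ∃ L, cs.IsLinear L ∧ ∃ t, ∀ x, f x ∈ range g → f x = g (L x + t) := by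
  obtain ⟨-, -, w, hw, h⟩ := B.A2 f hf g hg
  obtain ⟨L, hL, t, ht⟩ := exists_affine_of_mem_W hw
  exact ⟨L, hL, t, fun x hx => by rw [h x hx, ht]⟩

theorem exists_add_mem_range_of_subset (hf : f ∈ B.charts) (hv : cs.IsRegular v) {T R : Set X}
    (hT : IsSector cs B.charts T) (hTf : T ⊆ f '' cs.chamber v) (hTR : T ⊆ R) :
    ∃ u, ∀ y ∈ cs.chamber v, f (u + y) ∈ R := by
  obtain ⟨_, f₁, hf₁, x₁, s₁, hs₁, -, rfl⟩ := hT
  obtain ⟨v₁, hv₁, rfl⟩ := hs₁.exists_eq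
  obtain ⟨L, hL, t, h⟩ := B.exists_transition hf₁ hf
  have hmem : ∀ w ∈ cs.chamber v₁, f₁ (x₁ + w) ∈ f₁ '' {y | y - x₁ ∈ cs.chamber v₁} := fun w hw =>
    ⟨x₁ + w, by simpa using hw, rfl⟩
  have heq : ∀ w ∈ cs.chamber v₁, f₁ (x₁ + w) = f (L x₁ + t + L w) := fun w hw => by
    rw [h _ (image_subset_range f _ (hTf (hmem w hw))), map_add]
    congr 1; abel
  have hin : ∀ w ∈ cs.chamber v₁, L x₁ + t + L w ∈ cs.chamber v := fun w hw => by
    obtain ⟨y, hy, hyw⟩ := hTf (hmem w hw)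
    rw [heq w hw] at hyw
    rwa [← (B.isom f hf).injective hyw]
  have hLv : L v₁ ∈ cs.chamber v := by
    have := isClosed_chamber.add_mem_of_ray convex_chamber (zero_mem_chamber (v := v))
      (u := L x₁ + t) (y := L v₁) fun ρ hρ => by
        rw [← map_smul]
        exact hin _ (smul_mem_chamber hρ self_mem_chamber)
    rwa [zero_add] at this
  refine ⟨L x₁ + t, fun y hy => ?_⟩
  rw [← chamber_eq_of_mem (hv₁.map hL) hv hLv] at hy
  have hy' := map_mem_chamber hL.symm hy
  rw [L.symm_apply_apply] at hy'
  have h2 := heq _ hy'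
  rw [L.apply_symm_apply] at h2
  rw [← h2]
  exact hTR (hmem _ hy')

theorem isSector_image_chamber (hf : f ∈ B.charts) (hv : cs.IsRegular v) :
    IsSector cs B.charts (f '' cs.chamber v) :=
  ⟨f 0, f, hf, 0, _, hv.isModelSector 0, rfl, by simp⟩

/-- Two sectors have subsectors in a common apartment; the chart of this apartment can be chosen
to agree with the chart of the first sector. -/
theorem exists_agreeOn (hf : f ∈ B.charts) (hg : g ∈ B.charts) (hv : cs.IsRegular v)
    (he : cs.IsRegular e) :
    ∃ k ∈ B.charts, cs.AgreeOn f k v ∧ ∃ L, cs.IsLinear L ∧ ∃ u t, ∀ y ∈ cs.chamber e,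
      g (u + y) = k (L y + t) := by
  obtain ⟨T₁, T₂, k, hk, hT₁, hT₂, h₁, h₂, h₁k, h₂k⟩ :=
    B.A4 _ _ (B.isSector_image_chamber hf hv) (B.isSector_image_chamber hg he)
  obtain ⟨u₁, hu₁⟩ := B.exists_add_mem_range_of_subset hf hv hT₁ h₁ h₁k
  obtain ⟨u₂, hu₂⟩ := B.exists_add_mem_range_of_subset hg he hT₂ h₂ h₂k
  obtain ⟨L₁, hL₁, t₁, hk₁⟩ := B.exists_transition hf hk
  obtain ⟨L₂, hL₂, t₂, hk₂⟩ := B.exists_transition hg hk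
  refine ⟨_, B.comp_affine_mem hk hL₁ t₁, ⟨u₁, fun y hy => hk₁ _ (hu₁ y hy)⟩,
    L₂.trans L₁.symm, hL₂.trans hL₁.symm, u₂, L₁.symm (L₂ u₂ + t₂ - t₁), fun y hy => ?_⟩
  rw [hk₂ _ (hu₂ y hy), LinearIsometryEquiv.trans_apply, ← map_add, L₁.apply_symm_apply, map_add]
  congr 1; abel

theorem asymptoticRays_of_eq (hg : g ∈ B.charts) (hk : k ∈ B.charts) {u t : ModelSpace n}
    (h : ∀ y ∈ cs.chamber e, g (u + y) = k (L y + t)) {y : ModelSpace n} (hy : y ∈ cs.chamber e) :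
    AsymptoticRays g y k (L y) :=
  .of_eq (B.isom g hg) (B.isom k hk) (u := u) (t := t) fun ρ hρ => by
    rw [h _ (smul_mem_chamber hρ hy), map_smul]

theorem exists_asymptoticOn (hf : f ∈ B.charts) (hg : g ∈ B.charts) (hv : cs.IsRegular v)
    (he : cs.IsRegular e) :
    ∃ k ∈ B.charts, cs.AsymptoticOn f k v ∧ ∃ L, cs.IsLinear L ∧ ∀ y ∈ cs.chamber e,
      AsymptoticRays g y k (L y) := by
  obtain ⟨k, hk, hfk, L, hL, u, t, h⟩ := B.exists_agreeOn hf hg hv he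
  exact ⟨k, hk, hfk.asymptoticOn (B.isom f hf) (B.isom k hk), L, hL, fun y hy =>
    B.asymptoticRays_of_eq hg hk h hy⟩

/-- Asymptotic charts agree on a subsector up to a translation. -/
theorem exists_eq_add (hf : f ∈ B.charts) (hk : k ∈ B.charts) (hv : cs.IsRegular v)
    (hfk : cs.AsymptoticOn f k v) : ∃ t, cs.AgreeOn f (fun y => k (y + t)) v := by
  obtain ⟨l, hl, hfl, L, hL, u', t, h⟩ := B.exists_agreeOn hf hk hv hv
  have hLy : ∀ y ∈ cs.chamber v, L y = y := fun y hy =>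
    (((hfl.asymptoticOn (B.isom f hf) (B.isom l hl) y hy).symm.trans (hfk y hy)).trans
      (B.asymptoticRays_of_eq hk hl h hy)).eq (B.isom l hl) |>.symm
  obtain ⟨u, hu⟩ := hfl
  obtain ⟨x, hx, hx'⟩ := exists_sub_mem_chamber (cs := cs) v u t
  refine ⟨u' - t, x, fun y hy => ?_⟩
  have h1 := hu _ (add_mem_chamber hx hy)
  have h2 := h _ (add_mem_chamber hx' hy)
  rw [hLy _ (add_mem_chamber hx' hy)] at h2
  rw [show u + (x - u + y) = x + y by abel] at h1
  rw [show x - t + y + t = x + y by abel] at h2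
  change f (x + y) = k (x + y + (u' - t))
  rw [h1, ← h2]
  congr 1; abel

theorem add_mem_range (hf : f ∈ B.charts) (hg : g ∈ B.charts) {u z y : ModelSpace n}
    (hz : f z ∈ range g) (h : ∀ ρ : ℝ, 0 ≤ ρ → f (u + ρ • y) ∈ range g) : f (z + y) ∈ range g :=
  (B.A2 f hf g hg).1.add_mem_of_ray (B.A2 f hf g hg).2.1 hz h

/-- Charts which agree on a subsector agree wherever their images meet. -/
theorem eq_of_agreeOn (hf : f ∈ B.charts) (hg : g ∈ B.charts) (hfg : cs.AgreeOn f g v)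
    {y : ModelSpace n} (hy : f y ∈ range g) : f y = g y := by
  obtain ⟨L, hL, t, h⟩ := B.exists_transition hf hg
  obtain ⟨u, hu⟩ := hfg
  have h1 : ∀ y ∈ cs.chamber v, L u + L y + t = u + y := fun y hy =>
    (B.isom g hg).injective <| by
      rw [← hu y hy, h _ ⟨u + y, (hu y hy).symm⟩, map_add]
  have h2 := h1 0 zero_mem_chamber
  rw [map_zero, add_zero, add_zero] at h2
  have h3 := eq_self_of_eq_self_on_chamber (L := L) fun y hy => by
    have := h1 y hy
    rw [add_right_comm, h2] at this
    exact add_left_cancel this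
  rw [h3, add_eq_left] at h2
  rw [h y hy, h3, h2, add_zero]

theorem eq_and_eq_of_agreeOn (hf : f ∈ B.charts) (hg : g ∈ B.charts) (hfg : cs.AgreeOn f g v)
    {z z' : ModelSpace n} (hz : f z = g z') :
    z = z' ∧ ∀ y ∈ cs.chamber v, f (z + y) = g (z + y) := by
  have hr : f z ∈ range g := ⟨z', hz.symm⟩
  refine ⟨(B.isom g hg).injective ((B.eq_of_agreeOn hf hg hfg hr).symm.trans hz), fun y hy => ?_⟩
  refine B.eq_of_agreeOn hf hg hfg ?_
  obtain ⟨u, hu⟩ := id hfg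
  exact B.add_mem_range hf hg hr fun ρ hρ =>
    ⟨u + ρ • y, (hu _ (smul_mem_chamber hρ hy)).symm⟩

end RBuilding

theorem range_comp_affine {Y : Type*} {n : ℕ} (f : ModelSpace n → Y) (L : ModelSpace n ≃ₗᵢ[ℝ] ModelSpace n)
    (t : ModelSpace n) : range (fun y => f (L y + t)) = range f := by
  refine Function.Surjective.range_comp (f := fun y => L y + t) (fun y => ⟨L.symm (y - t), ?_⟩) f
  simp

theorem range_comp_add {Y : Type*} {n : ℕ} (f : ModelSpace n → Y) (t : ModelSpace n) :
    range (fun y => f (y + t)) = range f :=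
  range_comp_affine f (.refl ℝ _) t

namespace RBuilding

open SphericalCoxeterSystem

variable {n : ℕ} {cs : SphericalCoxeterSystem n} {X : Type*} [MetricSpace X] {Λ : Set X}
  (B : RBuilding cs X Λ) {f g h k : ModelSpace n → X} {v e a m y z z' : ModelSpace n}
  {L : ModelSpace n ≃ₗᵢ[ℝ] ModelSpace n}

/-- The relation `z = ρ y`, where `ρ` is the retraction of the apartment of `k` onto the apartment
of `f` centred at the direction of the sector spanned by the chamber of `v`. -/
def IsRetraction (f k : ModelSpace n → X) (v y z : ModelSpace n) : Prop :=
  ∃ l ∈ B.charts, cs.AsymptoticOn f l v ∧ AsymptoticRays k y l z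

theorem isRetraction_of_asymptoticRays (hf : f ∈ B.charts) (h : AsymptoticRays k y f z) :
    B.IsRetraction f k v y z := ⟨f, hf, .refl f v, h⟩

variable {B}

theorem IsRetraction.eq (hz : B.IsRetraction f k v y z) (hz' : B.IsRetraction f k v y z') :
    z = z' := by
  obtain ⟨l, hl, hfl, h⟩ := hz
  obtain ⟨l', hl', hfl', h'⟩ := hz'
  exact eq_of_forall_dist_eq fun d hd => AsymptoticRays.dist_eq (B.isom l hl) (B.isom l' hl')
    ((hfl d hd).symm.trans (hfl' d hd)) (h.symm.trans h')

variable (B)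

include B

theorem exists_isRetraction (hf : f ∈ B.charts) (hk : k ∈ B.charts) (hv : cs.IsRegular v)
    (y : ModelSpace n) : ∃ z, B.IsRetraction f k v y z := by
  obtain ⟨e, he, hy⟩ := exists_isRegular_mem_chamber (cs := cs) y
  obtain ⟨l, hl, hfl, L, hL, h⟩ := B.exists_asymptoticOn hf hk hv he
  exact ⟨L y, l, hl, hfl, h y hy⟩

variable {B}

theorem IsRetraction.dist_le (hf : f ∈ B.charts) (hk : k ∈ B.charts) (hv : cs.IsRegular v)
    {y' : ModelSpace n} (hz : B.IsRetraction f k v y z) (hz' : B.IsRetraction f k v y' z') :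
    dist z z' ≤ dist y y' := by
  choose ρ hρ using B.exists_isRetraction (v := v) hf hk hv
  rw [hz.eq (hρ y), hz'.eq (hρ y')]
  let ι := {C | ∃ e, cs.IsRegular e ∧ C = cs.chamber e}
  have : Finite ι := (finite_setOf_chamber (cs := cs)).subset fun C ⟨e, he, h⟩ => ⟨e, h.symm⟩
  have := Fintype.ofFinite ι
  let c : ℝ → ModelSpace n := fun t => AffineMap.lineMap y y' t
  have hc : Continuous c := AffineMap.lineMap_continuous
  have key := dist_le_of_finite_closed_cover (φ := fun t => ρ (c t)) (C := dist y y') (p := 0)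
    (q := 1) (T := fun C : ι => c ⁻¹' C) ?_ ?_ Finset.univ zero_le_one ?_
  · simpa [c] using key
  · rintro ⟨_, e, he, rfl⟩
    exact isClosed_chamber.preimage hc
  · rintro ⟨_, e, he, rfl⟩ s hs t ht hst
    obtain ⟨l, hl, hfl, L, hL, h⟩ := B.exists_asymptoticOn hf hk hv he
    have hc1 : ∀ t ∈ c ⁻¹' cs.chamber e, ρ (c t) = L (c t) := fun t ht =>
      (hρ _).eq ⟨l, hl, hfl, h _ ht⟩
    rw [hc1 s hs, hc1 t ht, L.dist_map, dist_lineMap_lineMap, Real.dist_eq, abs_sub_comm,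
      abs_of_nonneg (sub_nonneg.2 hst), mul_comm]
  · intro t _
    obtain ⟨e, he, hy⟩ := exists_isRegular_mem_chamber (cs := cs) (c t)
    exact mem_iUnion₂.2 ⟨⟨_, e, he, rfl⟩, Finset.mem_univ _, hy⟩

variable (B)

/-- Two apartments sharing a panel at infinity, and a chamber at infinity opposite to a chamber on
this panel, intersect in at least a half-apartment. -/
theorem eq_on_halfSpace_of_asymptoticOn (hP : cs.IsPanel v a m) (hf : f ∈ B.charts)
    (hk : k ∈ B.charts) (h₁ : cs.AsymptoticOn f k (-hyperplaneReflection a v))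
    (h₂ : ∀ y ∈ cs.chamber v, ⟪a, y⟫ = 0 → AsymptoticRays f y k y) :
    cs.AsymptoticOn f k v ∧ ∃ t, ∃ b : ℝ, ∀ y, b ≤ ⟪a, y⟫ → f y = k (y + t) := by
  have ha := hP.isRoot.norm_eq
  have hv := hP.isRegular
  have hv₁ := hP.reflect.isRegular
  have hfk : cs.AsymptoticOn f k v := by
    obtain ⟨l, hl, hfl, L, hL, h⟩ := B.exists_asymptoticOn hf hk hv hv
    have hLp : ∀ y ∈ cs.chamber v, ⟪a, y⟫ = 0 → L y = y := fun y hy hy0 =>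
      IsRetraction.eq ⟨l, hl, hfl, h y hy⟩
        (B.isRetraction_of_asymptoticRays hf (h₂ y hy hy0).symm)
    rcases hP.eq_self_or_eq_reflection L hLp with hL1 | hL1
    · intro y hy
      have := h y hy
      rw [hL1] at this
      exact (hfl y hy).trans this.symm
    · exfalso
      have hle := IsRetraction.dist_le hf hk hv ⟨l, hl, hfl, h v self_mem_chamber⟩
        (B.isRetraction_of_asymptoticRays hf (h₁ _ self_mem_chamber).symm)
      have hpar := parallelogram_law_with_norm ℝ v (hyperplaneReflection a v)
      have hne : 0 < ‖v - hyperplaneReflection a v‖ := by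
        rw [norm_pos_iff, sub_ne_zero]
        intro h0
        have := inner_self_hyperplaneReflection ha v
        rw [← h0] at this
        linarith [hP.pos]
      rw [hL1, dist_eq_norm, dist_eq_norm, sub_neg_eq_add, sub_neg_eq_add, ← two_smul ℝ,
        norm_smul, LinearIsometryEquiv.norm_map, Real.norm_ofNat] at hle
      rw [LinearIsometryEquiv.norm_map] at hpar
      nlinarith [norm_nonneg v]
  refine ⟨hfk, ?_⟩
  obtain ⟨t₁, hag⟩ := B.exists_eq_add hf hk hv hfk
  obtain ⟨t₂, u₂, hu₂⟩ := B.exists_eq_add hf hk hv₁.neg h₁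
  obtain ⟨u₁, hu₁⟩ := id hag
  refine ⟨t₁, ⟪a, u₁⟫, fun y hy => B.eq_of_agreeOn hf (B.comp_add_mem hk t₁) hag ?_⟩
  rw [range_comp_add]
  obtain ⟨N, hN, hmem⟩ := hP.exists_smul_add_mem (y := y - u₁)
    (by rw [inner_sub_right]; linarith)
  have h3 : f (u₁ + (N • m + (y - u₁))) ∈ range k := ⟨_, (hu₁ _ hmem).symm⟩
  have h4 := B.add_mem_range hf hk h3 (u := u₂) (y := N • -m) fun ρ hρ =>
    ⟨_, (hu₂ _ (smul_mem_chamber hρ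
      (smul_mem_chamber hN (neg_mem_chamber hP.reflect.mem_chamber)))).symm⟩
  rwa [show u₁ + (N • m + (y - u₁)) + N • -m = y by rw [smul_neg]; abel] at h4

theorem asymptoticRays_comp_affine (hk : k ∈ B.charts) (L : ModelSpace n ≃ₗᵢ[ℝ] ModelSpace n)
    (t y : ModelSpace n) : AsymptoticRays (fun y => k (L y + t)) y k (L y) :=
  .of_eq ((B.isom k hk).comp ((IsometryEquiv.addRight t).isometry.comp L.isometry)) (B.isom k hk)
    (u := 0) (t := t) fun ρ _ => by rw [zero_add, map_smul]

/-- Let `f` and `g` be asymptotic on the chamber of `v`. Then there is a half-apartment of the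
apartment of `f`, bounded by a wall in the direction of the given panel, which is contained in the
apartment of a chart asymptotic to `g` on the adjacent chamber. -/
theorem exists_halfSpace_asymptoticOn (hP : cs.IsPanel v a m) (hf : f ∈ B.charts)
    (hg : g ∈ B.charts) (hfg : cs.AsymptoticOn f g v) :
    ∃ k ∈ B.charts, (∃ b : ℝ, ∀ y, b ≤ ⟪a, y⟫ → f y = k y) ∧
      cs.AsymptoticOn k g (hyperplaneReflection a v) := by
  have ha := hP.isRoot.norm_eq
  have hv₁ := hP.reflect.isRegular
  obtain ⟨k, hk, hfk, L, hL, h⟩ := B.exists_asymptoticOn hf hg hv₁.neg hv₁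
  have hLp : ∀ y ∈ cs.chamber v, ⟪a, y⟫ = 0 → L y = y := by
    intro y hy hy0
    have hy₁ := hP.mem_chamber_reflect hy hy0
    have hd := AsymptoticRays.dist_eq (B.isom f hf) (B.isom k hk)
      (hfk _ (neg_mem_chamber hy₁)) ((hfg y hy).trans (h y hy₁))
    have hpar := parallelogram_law_with_norm ℝ y (L y)
    rw [dist_eq_norm, dist_eq_norm, ← norm_neg, neg_sub, sub_neg_eq_add, ← norm_neg (-y - _),
      neg_sub, sub_neg_eq_add, ← two_smul ℝ, norm_smul, Real.norm_ofNat, add_comm (L y)] at hd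
    rw [← hd, LinearIsometryEquiv.norm_map] at hpar
    have h0 : ‖y - L y‖ * ‖y - L y‖ = 0 := by linarith
    rw [mul_self_eq_zero, norm_eq_zero, sub_eq_zero] at h0
    exact h0.symm
  obtain ⟨hfk', t, b, htb⟩ := B.eq_on_halfSpace_of_asymptoticOn hP hf hk hfk fun y hy hy0 => by
    have := h y (hP.mem_chamber_reflect hy hy0)
    rw [hLp y hy hy0] at this
    exact (hfg y hy).trans this
  refine ⟨_, B.comp_add_mem hk t, ⟨b, htb⟩, fun y hy => ?_⟩
  rcases hP.eq_self_or_eq_reflection L hLp with hL1 | hL1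
  · have := h y hy
    rw [hL1] at this
    exact (B.asymptoticRays_comp_affine hk (.refl ℝ _) t y).trans this.symm
  · exfalso
    have h1 := h _ (map_mem_chamber hP.isRoot.isLinear self_mem_chamber)
    rw [hL1, hyperplaneReflection_involutive] at h1
    have h2 := ((h1.trans (hfk' v self_mem_chamber).symm).trans (hfg v self_mem_chamber)).eq
      (B.isom g hg)
    have h3 := inner_self_hyperplaneReflection ha v
    rw [h2] at h3
    linarith [hP.pos]

theorem asymptoticRays_of_eq_on_halfSpace (hf : f ∈ B.charts) (hk : k ∈ B.charts)
    (ha : cs.IsRoot a) {b : ℝ} (h : ∀ y, b ≤ ⟪a, y⟫ → f y = k y) (hy : ⟪a, y⟫ = 0) :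
    AsymptoticRays f y k y :=
  .of_eq (B.isom f hf) (B.isom k hk) (u := b • a) (t := b • a) fun ρ _ => by
    rw [h, add_comm]
    rw [inner_add_right, inner_smul_right, inner_smul_right, ha.inner_self, hy]
    linarith

theorem range_subset_or_isHalfApartment (ha : cs.IsRoot a) (hf : f ∈ B.charts) (hk : k ∈ B.charts)
    {b : ℝ} (h : ∀ y, b ≤ ⟪a, y⟫ → f y ∈ range k) :
    range f ⊆ range k ∨ IsHalfApartment cs B.charts (range f ∩ range k) ∧
      ∃ b' : ℝ, ∀ y, f y ∈ range k ↔ b' ≤ ⟪a, y⟫ := by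
  obtain ⟨hc, hK, -⟩ := B.A2 f hf k hk
  rcases eq_univ_or_exists_eq_halfSpace ha.norm_eq hc hK h with h1 | ⟨b', hb'⟩
  · left
    rintro _ ⟨y, rfl⟩
    exact h1.symm.subset (mem_univ y)
  · have hb : ∀ y, f y ∈ range k ↔ b' ≤ ⟪a, y⟫ := fun y => Set.ext_iff.1 hb' y
    refine Or.inr ⟨⟨f, hf, _, _, ha.isModelHalf b', ?_⟩, b', hb⟩
    ext p
    constructor
    · rintro ⟨⟨y, rfl⟩, hy⟩
      exact ⟨y, (hb y).1 hy, rfl⟩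
    · rintro ⟨y, hy, rfl⟩
      exact ⟨mem_range_self y, (hb y).2 hy⟩

/-- If `f` and `g` are asymptotic on a chamber, the apartment of `f` is covered by two apartments
whose charts are asymptotic to `g` on a given adjacent chamber. -/
theorem exists_cover_of_isPanel (hP : cs.IsPanel v a m) (hf : f ∈ B.charts) (hg : g ∈ B.charts)
    (hfg : cs.AsymptoticOn f g v) :
    ∃ k₁ ∈ B.charts, ∃ k₂ ∈ B.charts, (∀ y, f y ∈ range k₁ ∨ f y ∈ range k₂) ∧
      cs.AsymptoticOn k₁ g (hyperplaneReflection a v) ∧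
      cs.AsymptoticOn k₂ g (hyperplaneReflection a v) := by
  have ha := hP.isRoot.norm_eq
  have hv₁ := hP.reflect.isRegular
  obtain ⟨k₁, hk₁, ⟨b₁, hb₁⟩, hk₁g⟩ := B.exists_halfSpace_asymptoticOn hP hf hg hfg
  obtain ⟨l, hl, hfl, L, hL, h⟩ := B.exists_asymptoticOn hf hg hv₁ hv₁
  have hLp : ∀ y ∈ cs.chamber v, ⟪a, y⟫ = 0 → L y = y := fun y hy hy0 => by
    have hy₁ := hP.mem_chamber_reflect hy hy0
    exact ((((hfl y hy₁).symm.trans (hfg y hy)).trans (h y hy₁)).eq (B.isom l hl)).symm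
  rcases hP.eq_self_or_eq_reflection L hLp with hL1 | hL1
  · have hfg₁ : cs.AsymptoticOn f g (hyperplaneReflection a v) := fun y hy => by
      have := h y hy
      rw [hL1] at this
      exact (hfl y hy).trans this.symm
    exact ⟨f, hf, f, hf, fun y => Or.inl ⟨y, rfl⟩, hfg₁, hfg₁⟩
  obtain ⟨k₀, hk₀, ⟨b₂, hb₂⟩, hk₀l⟩ := B.exists_halfSpace_asymptoticOn hP.reflect hf hl hfl
  rw [hyperplaneReflection_neg _ _ ha, hyperplaneReflection_involutive] at hk₀l
  let k₂ : ModelSpace n → X := fun y => k₀ (hyperplaneReflection a y + 0)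
  have hk₂ : k₂ ∈ B.charts := B.comp_affine_mem hk₀ hP.isRoot.isLinear 0
  have hrange : range k₂ = range k₀ := range_comp_affine k₀ _ 0
  have hasy : ∀ y, AsymptoticRays k₂ y k₀ (hyperplaneReflection a y) := fun y =>
    B.asymptoticRays_comp_affine hk₀ _ 0 y
  have hk₂g : cs.AsymptoticOn k₂ g (hyperplaneReflection a v) := fun y hy => by
    have h1 := map_mem_chamber hP.isRoot.isLinear hy
    rw [hyperplaneReflection_involutive] at h1
    have h2 := h y hy
    rw [hL1] at h2
    exact ((hasy y).trans (hk₀l _ h1)).trans h2.symm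
  have hb₂' : ∀ y, b₂ ≤ ⟪-a, y⟫ → f y ∈ range k₂ := fun y hy => by
    rw [hrange, hb₂ y hy]; exact mem_range_self y
  have hb₁' : ∀ y, b₁ ≤ ⟪a, y⟫ → f y ∈ range k₁ := fun y hy => by
    rw [hb₁ y hy]; exact mem_range_self y
  refine ⟨k₁, hk₁, k₂, hk₂, ?_, hk₁g, hk₂g⟩
  rcases B.range_subset_or_isHalfApartment hP.isRoot hf hk₁ hb₁' with h1 | ⟨hh₁, c₁, hc₁⟩
  · exact fun y => Or.inl (h1 (mem_range_self y))
  rcases B.range_subset_or_isHalfApartment hP.isRoot.neg hf hk₂ hb₂' with h2 | ⟨hh₂, c₂, hc₂⟩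
  · exact fun y => Or.inr (h2 (mem_range_self y))
  have h12 : cs.AsymptoticOn k₁ k₂ (-hyperplaneReflection (-a) (-v)) := by
    rw [map_neg, neg_neg, hyperplaneReflection_neg _ _ ha]
    exact hk₁g.trans hk₂g.symm
  obtain ⟨-, t, b₃, hb₃⟩ := B.eq_on_halfSpace_of_asymptoticOn hP.neg hk₁ hk₂ h12 fun y _ hy => by
    have hy' : ⟪a, y⟫ = 0 := by rwa [inner_neg_left, neg_eq_zero] at hy
    have h3 := (B.asymptoticRays_of_eq_on_halfSpace hf hk₁ hP.isRoot hb₁ hy').symm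
    have h4 := B.asymptoticRays_of_eq_on_halfSpace hf hk₀ hP.isRoot.neg hb₂ hy
    have h5 := hasy y
    rw [hyperplaneReflection_of_inner_eq_zero ha hy'] at h5
    exact (h3.trans h4).trans h5.symm
  rcases B.range_subset_or_isHalfApartment hP.isRoot.neg hk₁ hk₂ (b := b₃)
    (fun y hy => ⟨y + t, (hb₃ y hy).symm⟩) with h3 | ⟨hh₃, -⟩
  · intro y
    by_cases hy : c₁ ≤ ⟪a, y⟫
    · exact Or.inl ((hc₁ y).2 hy)
    · right
      have h4 := h3 ((hc₁ (c₁ • a)).2 (by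
        rw [inner_smul_right, hP.isRoot.inner_self, mul_one]))
      rw [hc₂, inner_neg_left, inner_smul_right, hP.isRoot.inner_self] at h4
      rw [hc₂, inner_neg_left]
      linarith
  · obtain ⟨_, ⟨⟨y₀, rfl⟩, h4⟩, h5⟩ := B.A5 f hf k₁ hk₁ k₂ hk₂ hh₁ hh₃ hh₂
    intro y
    rw [hc₁] at h4 ⊢
    rw [hc₂, inner_neg_left] at h5 ⊢
    by_cases hy : c₁ ≤ ⟪a, y⟫
    · exact Or.inl hy
    · right; linarith

end RBuilding

namespace RBuilding

open SphericalCoxeterSystem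

variable {n : ℕ} {cs : SphericalCoxeterSystem n} {X : Type*} [MetricSpace X] {Λ : Set X}
  (B : RBuilding cs X Λ) {f g h : ModelSpace n → X} {v d x y z : ModelSpace n}

include B

/-- If `f` and `g` are asymptotic on one chamber, the apartment of `f` is covered by finitely many
apartments whose charts are asymptotic to `g` on any given chamber. -/
theorem exists_finite_cover_of_asymptoticOn (hf : f ∈ B.charts) (hg : g ∈ B.charts)
    (hv : cs.IsRegular v) (hd : cs.IsRegular d) (hfg : cs.AsymptoticOn f g v) :
    ∃ J : Set (ModelSpace n → X), J.Finite ∧ (∀ h ∈ J, h ∈ B.charts ∧ cs.AsymptoticOn h g d) ∧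
      ∀ y, ∃ h ∈ J, f y ∈ range h := by
  induction hN : {b | cs.IsRoot b ∧ 0 < ⟪b, v⟫ ∧ ⟪b, d⟫ < 0}.ncard using Nat.strong_induction_on
    generalizing v f with
  | _ N ih =>
    by_cases hdv : d ∈ cs.chamber v
    · refine ⟨{f}, finite_singleton f, ?_, fun y => ⟨f, rfl, y, rfl⟩⟩
      rintro _ rfl
      refine ⟨hf, ?_⟩
      rw [AsymptoticOn, chamber_eq_of_mem hd hv hdv]
      exact hfg
    · obtain ⟨a, m, hP, had⟩ := exists_isPanel hv hdv
      obtain ⟨k₁, hk₁, k₂, hk₂, hcov, h₁, h₂⟩ := B.exists_cover_of_isPanel hP hf hg hfg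
      have hlt : {b | cs.IsRoot b ∧ 0 < ⟪b, hyperplaneReflection a v⟫ ∧ ⟪b, d⟫ < 0}.ncard < N := by
        rw [← hN]
        refine ncard_lt_ncard ⟨?_, fun hsub => ?_⟩
          (finite_setOf_isRoot.subset fun b hb => hb.1)
        · rintro b ⟨hb, hbv, hbd⟩
          refine ⟨hb, ?_, hbd⟩
          have hba : b ≠ a := by
            rintro rfl
            rw [inner_self_hyperplaneReflection hb.norm_eq] at hbv
            linarith [hP.pos]
          have hba' : b ≠ -a := by
            rintro rfl
            rw [inner_neg_left] at hbd
            linarith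
          have h3 := hP.reflect.mul_pos b hb hba' (by rwa [neg_neg])
          have h4 := hP.mul_pos b hb hba hba'
          exact (pos_iff_pos_of_mul_pos h4).1 ((pos_iff_pos_of_mul_pos h3).2 hbv)
        · have h3 := (hsub (show a ∈ _ from ⟨hP.isRoot, hP.pos, had⟩)).2.1
          rw [inner_self_hyperplaneReflection hP.isRoot.norm_eq] at h3
          linarith [hP.pos]
      obtain ⟨J₁, hJ₁, hJc₁, hJr₁⟩ := ih _ hlt hk₁ hP.reflect.isRegular h₁ rfl
      obtain ⟨J₂, hJ₂, hJc₂, hJr₂⟩ := ih _ hlt hk₂ hP.reflect.isRegular h₂ rfl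
      refine ⟨J₁ ∪ J₂, hJ₁.union hJ₂, fun h hh => hh.elim (hJc₁ h) (hJc₂ h), fun y => ?_⟩
      rcases hcov y with ⟨z, hz⟩ | ⟨z, hz⟩
      · obtain ⟨h, hh, hr⟩ := hJr₁ z
        exact ⟨h, Or.inl hh, by rwa [← hz]⟩
      · obtain ⟨h, hh, hr⟩ := hJr₂ z
        exact ⟨h, Or.inr hh, by rwa [← hz]⟩

/-- Every apartment is covered by finitely many apartments containing a subsector of a given
sector. -/
theorem exists_finite_cover (hf : f ∈ B.charts) (hg : g ∈ B.charts) (hd : cs.IsRegular d) :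
    ∃ J : Set (ModelSpace n → X), J.Finite ∧ (∀ h ∈ J, h ∈ B.charts ∧ cs.AgreeOn h g d) ∧
      ∀ y, ∃ h ∈ J, f y ∈ range h := by
  obtain ⟨l, hl, hfl, L, hL, hgl⟩ := B.exists_asymptoticOn hf hg hd hd
  obtain ⟨J, hJ, hJc, hJr⟩ := B.exists_finite_cover_of_asymptoticOn hf hl hd (hd.map hL) hfl
  have key : ∀ h ∈ J, ∃ h' ∈ B.charts, cs.AgreeOn h' g d ∧ range h' = range h := by
    intro h hh
    obtain ⟨hhc, hhl⟩ := hJc h hh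
    have h1 := B.comp_affine_mem hhc hL 0
    obtain ⟨t, ht⟩ := B.exists_eq_add hg h1 hd fun y hy =>
      ((hgl y hy).trans (hhl _ (map_mem_chamber hL hy)).symm).trans
        (B.asymptoticRays_comp_affine hhc L 0 y).symm
    exact ⟨_, B.comp_add_mem h1 t, ht.symm, 
      (range_comp_add (fun y => h (L y + 0)) t).trans (range_comp_affine h L 0)⟩
  choose! F hF hFg hFr using key
  refine ⟨F '' J, hJ.image F, ?_, fun y => ?_⟩
  · rintro _ ⟨h, hh, rfl⟩
    exact ⟨hF h hh, hFg h hh⟩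
  · obtain ⟨h, hh, hr⟩ := hJr y
    exact ⟨F h, mem_image_of_mem F hh, by rwa [hFr h hh]⟩

theorem exists_agreeOn_mem_range {p : X} (hp : p ∈ Λ) (hg : g ∈ B.charts) (hd : cs.IsRegular d) :
    ∃ h ∈ B.charts, cs.AgreeOn h g d ∧ p ∈ range h := by
  obtain ⟨f, hf, ⟨y, rfl⟩, -⟩ := B.A3 p hp p hp
  obtain ⟨J, -, hJc, hJr⟩ := B.exists_finite_cover hf hg hd
  obtain ⟨h, hh, hr⟩ := hJr y
  exact ⟨h, (hJc h hh).1, (hJc h hh).2, hr⟩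

/-- Parallel sectors based at nearby points intersect: they share every point lying sufficiently
deep in the interior of one of them. -/
theorem eq_of_dist_lt (hf : f ∈ B.charts) (hh : h ∈ B.charts) (hv : cs.IsRegular v)
    (hfh : cs.AgreeOn h f v) {δ : ℝ} (hδ : dist (f x) (h z) < δ)
    (hball : ∀ w, dist w y < δ → w - x ∈ cs.chamber v) : f y = h y := by
  obtain ⟨q, hq, ⟨q₀, hq₀⟩, q₁, hq₁⟩ :=
    B.A3 _ (B.into f hf (mem_range_self x)) _ (B.into h hh (mem_range_self z))
  obtain ⟨J, hJ, hJc, hJr⟩ := B.exists_finite_cover hq hf hv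
  choose H hHJ Z hZ using hJr
  have hH : ∀ p, H p ∈ B.charts := fun p => (hJc _ (hHJ p)).1
  have hHf : ∀ p, cs.AgreeOn (H p) f v := fun p => (hJc _ (hHJ p)).2
  have hdist : dist q₀ q₁ < δ := by rwa [← (B.isom q hq).dist_eq, hq₀, hq₁]
  let c : ℝ → ModelSpace n := fun t => AffineMap.lineMap q₀ q₁ t
  have hc : Continuous c := AffineMap.lineMap_continuous
  have hc0 : c 0 = q₀ := AffineMap.lineMap_apply_zero _ _
  have hc1 : c 1 = q₁ := AffineMap.lineMap_apply_one _ _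
  have := hJ.fintype
  let T : J → Set ℝ := fun j => c ⁻¹' {p | q p ∈ range j.1}
  have hT : ∀ j, IsClosed (T j) := fun j => (B.A2 q hq j.1 (hJc _ j.2).1).1.preimage hc
  have hcov : ∀ t, ∃ j, t ∈ T j := fun t => ⟨⟨H (c t), hHJ _⟩, Z (c t), hZ _⟩
  have hTZ : ∀ j : J, ∀ t ∈ T j, j.1 (Z (c t)) = q (c t) ∧
      ∀ w ∈ cs.chamber v, H (c t) (Z (c t) + w) = j.1 (Z (c t) + w) := by
    rintro j t ⟨p, hp⟩
    obtain ⟨h1, h2⟩ := B.eq_and_eq_of_agreeOn (hH _) (hJc _ j.2).1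
      ((hHf (c t)).trans (hJc _ j.2).2.symm) ((hZ (c t)).trans hp.symm)
    exact ⟨by rw [h1, hp], h2⟩
  obtain ⟨hx, hx'⟩ := B.eq_and_eq_of_agreeOn (hH _) hf (hHf q₀) ((hZ q₀).trans hq₀)
  obtain ⟨hz, hz'⟩ := B.eq_and_eq_of_agreeOn (hH _) hh ((hHf q₁).trans hfh.symm)
    ((hZ q₁).trans hq₁)
  have hφ : ∀ t ∈ Icc (0 : ℝ) 1, dist x (Z (c t)) ≤ dist q₀ q₁ := by
    intro t ht
    have h1 := dist_le_of_finite_closed_cover (φ := fun t => Z (c t)) (C := dist q₀ q₁) hT ?_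
      Finset.univ ht.1 ?_
    · simp only [hc0, hx, sub_zero] at h1
      exact h1.trans (mul_le_of_le_one_right dist_nonneg ht.2)
    · intro j s hs t ht hst
      rw [← (B.isom j.1 (hJc _ j.2).1).dist_eq, (hTZ j s hs).1, (hTZ j t ht).1,
        (B.isom q hq).dist_eq, dist_lineMap_lineMap, Real.dist_eq, abs_sub_comm,
        abs_of_nonneg (sub_nonneg.2 hst), mul_comm]
    · intro t _
      obtain ⟨j, hj⟩ := hcov t
      exact mem_iUnion₂.2 ⟨j, Finset.mem_univ _, hj⟩
  have hmem : ∀ t ∈ Icc (0 : ℝ) 1, y - Z (c t) ∈ cs.chamber v := by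
    intro t ht
    have h1 := hball (y + (x - Z (c t))) (by
      rw [dist_eq_norm, add_sub_cancel_left, ← dist_eq_norm]
      exact (hφ t ht).trans_lt hdist)
    rwa [show y + (x - Z (c t)) - x = y - Z (c t) by abel] at h1
  have hψ := dist_le_of_finite_closed_cover (φ := fun t => H (c t) y) (C := 0)
    (T := fun j => T j ∩ Icc 0 1) (fun j => (hT j).inter isClosed_Icc) ?_ Finset.univ
    (zero_le_one' ℝ) ?_
  · rw [zero_mul] at hψ
    have h0 : H (c 0) y = H (c 1) y := dist_le_zero.1 hψ
    have hy0 := hmem 0 ⟨le_rfl, zero_le_one⟩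
    have hy1 := hmem 1 ⟨zero_le_one, le_rfl⟩
    rw [hc0] at h0 hy0
    rw [hc1] at h0 hy1
    have h1 := hx' _ hy0
    have h2 := hz' _ hy1
    rw [add_sub_cancel] at h1 h2
    rw [← h1, h0, h2]
  · rintro j s ⟨hs, hs'⟩ t ⟨ht, ht'⟩ -
    have h1 := (hTZ j s hs).2 _ (hmem s hs')
    have h2 := (hTZ j t ht).2 _ (hmem t ht')
    rw [add_sub_cancel] at h1 h2
    rw [h1, h2, dist_self, zero_mul]
  · intro t ht
    obtain ⟨j, hj⟩ := hcov t
    exact mem_iUnion₂.2 ⟨j, Finset.mem_univ _, hj, ht⟩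

/-- The chart of a sector parallel to a given sector can be reparametrized so that both charts agree
on a subsector. -/
theorem exists_agreeOn_of_par (hf : f ∈ B.charts) (hg : g ∈ B.charts) (hv : cs.IsRegular v)
    (hd : cs.IsRegular d)
    (hpar : Par (f '' {y | y - x ∈ cs.chamber v}) (g '' {y | y - z ∈ cs.chamber d})) :
    ∃ L, cs.IsLinear L ∧ ∃ t, cs.AgreeOn (fun y => g (L y + t)) f v := by
  obtain ⟨k, hk, hfk, L, hL, u, t, hgk⟩ := B.exists_agreeOn hf hg hv hd
  obtain ⟨r, hr⟩ := ENNReal.lt_iff_exists_nnreal_btwn.1 (lt_top_iff_ne_top.2 hpar)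
  obtain ⟨u', hu'⟩ := id hfk
  have hbdd : ∃ C : ℝ, ∀ ρ : ℝ, 0 ≤ ρ → ∃ w ∈ cs.chamber v, dist w (ρ • L d) ≤ C := by
    obtain ⟨C, hC⟩ := B.asymptoticRays_of_eq hg hk hgk self_mem_chamber
    refine ⟨‖u'‖ + ‖x - u'‖ + r + ‖z‖ + C, fun ρ hρ => ?_⟩
    obtain ⟨_, ⟨w, hw, rfl⟩, hlt⟩ := Metric.exists_edist_lt_of_hausdorffEDist_lt
      (x := g (z + ρ • d)) (s := g '' {y | y - z ∈ cs.chamber d})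
      (t := f '' {y | y - x ∈ cs.chamber v}) (r := r)
      ⟨_, by
        change z + ρ • d - z ∈ cs.chamber d
        rw [add_sub_cancel_left]
        exact smul_mem_chamber hρ self_mem_chamber, rfl⟩
      (by rw [Metric.hausdorffEDist_comm]; exact hr.1)
    refine ⟨w - x, hw, ?_⟩
    have h1 : dist (g (z + ρ • d)) (f w) < r := by rwa [edist_dist, ENNReal.ofReal_lt_coe_iff
      dist_nonneg] at hlt
    have h2 : dist (k (w - x)) (f (u' + (w - x))) = ‖u'‖ := by
      rw [hu' _ hw, (B.isom k hk).dist_eq, dist_eq_norm, sub_add_cancel_right, norm_neg]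
    have h3 : dist (f (u' + (w - x))) (f w) = ‖x - u'‖ := by
      rw [(B.isom f hf).dist_eq, dist_eq_norm, ← norm_neg]
      congr 1; abel
    have h4 : dist (g (z + ρ • d)) (g (ρ • d)) = ‖z‖ := by
      rw [(B.isom g hg).dist_eq, dist_eq_norm, add_sub_cancel_right]
    have h5 := hC ρ hρ
    rw [← (B.isom k hk).dist_eq]
    have h6 := dist_triangle4 (k (w - x)) (f (u' + (w - x))) (f w) (g (z + ρ • d))
    have h7 := dist_triangle4 (k (w - x)) (g (z + ρ • d)) (g (ρ • d)) (k (ρ • L d))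
    rw [dist_comm (f w)] at h6
    linarith
  have hLd : L d ∈ cs.chamber v := by
    obtain ⟨C, hC⟩ := hbdd
    intro a ha hav
    by_contra! hneg
    have hC0 : 0 ≤ C := by
      obtain ⟨w, -, hw⟩ := hC 0 le_rfl
      exact dist_nonneg.trans hw
    obtain ⟨w, hw, hwC⟩ := hC ((C + 1) / -⟪a, L d⟫) (by
      have := neg_pos.2 hneg; positivity)
    have h1 := hw a ha hav
    have h2 := real_inner_le_norm a (w - ((C + 1) / -⟪a, L d⟫) • L d)
    rw [ha.norm_eq, one_mul, ← dist_eq_norm, inner_sub_right, inner_smul_right] at h2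
    have h3 : (C + 1) / -⟪a, L d⟫ * ⟪a, L d⟫ = -(C + 1) := by
      field_simp [hneg.ne]
    rw [h3] at h2
    linarith
  have hgf : cs.AsymptoticOn f (fun y => g (L.symm y + 0)) v := fun y hy => by
    have hy' := hy
    rw [← chamber_eq_of_mem (hd.map hL) hv hLd] at hy'
    have h1 := map_mem_chamber hL.symm hy'
    rw [L.symm_apply_apply] at h1
    have h2 := B.asymptoticRays_of_eq hg hk hgk h1
    rw [L.apply_symm_apply] at h2
    exact ((hfk.asymptoticOn (B.isom f hf) (B.isom k hk) y hy).trans h2.symm).trans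
      (B.asymptoticRays_comp_affine hg L.symm 0 y).symm
  obtain ⟨t', ht'⟩ := B.exists_eq_add hf (B.comp_affine_mem hg hL.symm 0) hv hgf
  refine ⟨L.symm, hL.symm, L.symm t', ?_⟩
  simpa only [map_add, add_zero] using ht'.symm

end RBuilding

/-- **Corollary 9.** If the ℝ-building `(Λ,F)` is contained in a
metrically complete ℝ-building `(Λ',F')` of the same type, `α` is in the closure of
`Λ`, and `C_∞` is a chamber at infinity of `Λ` (represented by a sector `C₀` of `Λ`),
then the interior of the sector of `Λ'` based at `α` with direction `C_∞` lies in
`Λ`. -/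
theorem interior_sector_subset
    {n : ℕ} (cs : SphericalCoxeterSystem n) {X : Type*} [MetricSpace X]
    {Λ Λ' : Set X} (B : RBuilding cs X Λ) (B' : RBuilding cs X Λ')
    (hΛ : Λ ⊆ Λ') (hF : B.charts ⊆ B'.charts) (hcomplete : IsComplete Λ')
    (α : X) (hα : α ∈ closure Λ)
    (C₀ : Set X) (hC₀ : IsSector cs B.charts C₀)
    (f : ModelSpace n → X) (hf : f ∈ B'.charts)
    (x : ModelSpace n) (s : Set (ModelSpace n)) (hs : cs.IsModelSector x s)
    (hbase : f x = α) (hdir : Par (f '' s) C₀) :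
    f '' interior s ⊆ Λ := by
  subst hbase
  obtain ⟨v, hv, rfl⟩ := hs.exists_eq
  obtain ⟨_, g, hg, z, s₀, hs₀, -, rfl⟩ := hC₀
  obtain ⟨d, hd, rfl⟩ := hs₀.exists_eq
  obtain ⟨L, hL, t, hgf⟩ := B'.exists_agreeOn_of_par hf (hF hg) hv hd hdir
  rintro _ ⟨y, hy, rfl⟩
  obtain ⟨δ, hδ, hball⟩ := Metric.mem_nhds_iff.1 (mem_interior_iff_mem_nhds.1 hy)
  obtain ⟨β, hβ, hαβ⟩ := Metric.mem_closure_iff.1 hα δ hδ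
  obtain ⟨h, hh, hhg, w, rfl⟩ := B.exists_agreeOn_mem_range hβ (B.comp_affine_mem hg hL t) hv
  rw [B'.eq_of_dist_lt hf (hF hh) hv (hhg.trans hgf) hαβ fun w hw => hball hw]
  exact B.into h hh (mem_range_self y)
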